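/- arXiv:0809.0724 — 4 statements merged into one kernel-verified Lean document; each statement's English description precedes it below -/
import Mathlib

section
/- There exists a constant c > 0 such that for every integer ℓ ≥ 2, if a finite simple graph G has treewidth at least c·ℓ⁴·√(log ℓ), then the cartesian product G □ K₂ contains the complete graph K_ℓ as a minor. -/
open SimpleGraph

/-- `H` is a minor of `G`: there are nonempty, pairwise disjoint, connected
branch sets in `G`, one for each vertex of `H`, such that adjacent vertices
of `H` have an edge of `G` between their branch sets. -/
def MinorOf {α β : Type*} (H : SimpleGraph α) (G : SimpleGraph β) : Prop :=
  ∃ B : α → Set β,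
    (Pairwise fun a b => Disjoint (B a) (B b)) ∧
    (∀ a, (G.induce (B a)).Connected) ∧
    (∀ a b, H.Adj a b → ∃ u ∈ B a, ∃ v ∈ B b, G.Adj u v)

/-- A tree decomposition of a graph `G`. -/
structure TreeDecomp {V : Type} (G : SimpleGraph V) where
  ι : Type
  tree : SimpleGraph ι
  isTree : tree.IsTree
  bag : ι → Finset V
  mem_bag : ∀ v : V, ∃ i, v ∈ bag i
  adj_bag : ∀ u v : V, G.Adj u v → ∃ i, u ∈ bag i ∧ v ∈ bag i
  connected_bag : ∀ v : V, (tree.induce {i | v ∈ bag i}).Connected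

/-- The width of a tree decomposition: maximum bag size minus one. -/
noncomputable def TreeDecomp.width {V : Type} {G : SimpleGraph V}
    (td : TreeDecomp G) : ℕ :=
  sSup {n | ∃ i, n = (td.bag i).card} - 1

/-- The treewidth of a finite graph. -/
noncomputable def treewidth {V : Type} [Fintype V] (G : SimpleGraph V) : ℕ :=
  sInf {w | ∃ td : TreeDecomp G, td.width = w}

/-- A path in `G`, together with its endpoints. -/
def PathIn {V : Type} (G : SimpleGraph V) : Type := Σ u v : V, G.Path u v

/-- The set of vertices of a path. -/
def PathIn.verts {V : Type} {G : SimpleGraph V} (P : PathIn G) : Set V :=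
  {v | v ∈ (P.2.2 : G.Walk P.1 P.2.1).support}

/-- The intersection graph of a set of paths: two paths are adjacent iff they
are distinct and share a vertex. -/
def pathIntersectionGraph {V : Type} (G : SimpleGraph V)
    (𝒬 : Set (PathIn G)) : SimpleGraph 𝒬 :=
  SimpleGraph.fromRel fun P Q => ∃ v, v ∈ (P : PathIn G).verts ∧ v ∈ (Q : PathIn G).verts

/-- A grid-like-minor of order `ℓ` in `G`: a set of paths whose intersection
graph is bipartite and contains a `K_ℓ`-minor. -/
def IsGridLikeMinor {V : Type} (G : SimpleGraph V) (ℓ : ℕ)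
    (𝒬 : Set (PathIn G)) : Prop :=
  (pathIntersectionGraph G 𝒬).Colorable 2 ∧
    MinorOf (completeGraph (Fin ℓ)) (pathIntersectionGraph G 𝒬)

/-- Two subgraphs touch if they share a vertex or there is an edge of `G`
between them. -/
def Touch {V : Type} {G : SimpleGraph V} (X Y : G.Subgraph) : Prop :=
  (X.verts ∩ Y.verts).Nonempty ∨ ∃ u ∈ X.verts, ∃ v ∈ Y.verts, G.Adj u v

/-- A bramble: a set of pairwise touching connected subgraphs. -/
def IsBramble {V : Type} {G : SimpleGraph V} (ℬ : Set G.Subgraph) : Prop :=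
  (∀ X ∈ ℬ, X.Connected) ∧ ∀ X ∈ ℬ, ∀ Y ∈ ℬ, Touch X Y

/-- The order of a bramble is at least `k`: every hitting set has at least `k`
vertices. -/
def BrambleOrderAtLeast {V : Type} {G : SimpleGraph V} (ℬ : Set G.Subgraph)
    (k : ℕ) : Prop :=
  ∀ S : Finset V, (∀ X ∈ ℬ, ∃ v ∈ S, v ∈ X.verts) → k ≤ S.card

/-- The intersection graph of a set of subgraphs: two subgraphs are adjacent
iff they are distinct and share a vertex. -/
def subgraphIntersectionGraph {V : Type} (G : SimpleGraph V)
    (𝒳 : Set G.Subgraph) : SimpleGraph 𝒳 :=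
  SimpleGraph.fromRel fun X Q => ((X : G.Subgraph).verts ∩ (Q : G.Subgraph).verts).Nonempty

/-- A graph is `d`-degenerate if every nonempty (induced) subgraph has a vertex
of degree at most `d`. -/
def IsDegenerate {W : Type*} (d : ℕ) (G : SimpleGraph W) : Prop :=
  ∀ s : Set W, s.Nonempty → ∃ v ∈ s, {u | u ∈ s ∧ G.Adj v u}.ncard ≤ d

/-- A vertex set is connected in `G`: it is nonempty, and a nonempty subset which is closed under
adjacency within the set is the whole set. -/
def ConnSet {V : Type*} (G : SimpleGraph V) (X : Set V) : Prop :=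
  X.Nonempty ∧ ∀ Y ⊆ X, Y.Nonempty → (∀ v ∈ Y, ∀ w ∈ X, G.Adj v w → w ∈ Y) → X ⊆ Y

theorem connSet_iff_induce_connected {V : Type*} {G : SimpleGraph V} {X : Set V} :
    ConnSet G X ↔ (G.induce X).Connected := by
  constructor
  · rintro ⟨⟨a, ha⟩, h⟩
    have key : X ⊆ {v | ∃ hv : v ∈ X, (G.induce X).Reachable ⟨a, ha⟩ ⟨v, hv⟩} := by
      apply h
      · rintro v ⟨hv, -⟩
        exact hv
      · exact ⟨a, ha, Reachable.refl _⟩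
      · rintro v ⟨hv, hr⟩ w hw hvw
        exact ⟨hw, hr.trans (Adj.reachable (by simpa using hvw))⟩
    rw [connected_iff_exists_forall_reachable]
    refine ⟨⟨a, ha⟩, fun ⟨v, hv⟩ => ?_⟩
    obtain ⟨_, hr⟩ := key hv
    exact hr
  · intro h
    obtain ⟨a, ha⟩ := h.nonempty
    refine ⟨⟨a, ha⟩, fun Y hY ⟨y, hy⟩ hcl v hv => ?_⟩
    obtain ⟨p⟩ := h.preconnected ⟨y, hY hy⟩ ⟨v, hv⟩
    have : ∀ (u w : X) (_ : (G.induce X).Walk u w), (u : V) ∈ Y → (w : V) ∈ Y := by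
      intro u w p
      induction p with
      | nil => exact id
      | cons hadj _ ih => exact fun hu => ih (hcl _ hu _ (Subtype.coe_prop _) (by simpa using hadj))
    exact this _ _ p hy

theorem minorOf_iff {α β : Type*} {H : SimpleGraph α} {G : SimpleGraph β} :
    MinorOf H G ↔ ∃ B : α → Set β, (Pairwise fun a b => Disjoint (B a) (B b)) ∧
      (∀ a, ConnSet G (B a)) ∧ ∀ a b, H.Adj a b → ∃ u ∈ B a, ∃ v ∈ B b, G.Adj u v := by
  simp only [MinorOf, connSet_iff_induce_connected]

namespace ConnSet

variable {V : Type*} {G : SimpleGraph V} {X Y : Set V}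

theorem singleton (G : SimpleGraph V) (v : V) : ConnSet G {v} := by
  refine ⟨⟨v, rfl⟩, ?_⟩
  rintro Y hY ⟨y, hy⟩ - w rfl
  rwa [← Set.mem_singleton_iff.1 (hY hy)]

theorem mono {G' : SimpleGraph V} (hX : ConnSet G X) (h : G ≤ G') : ConnSet G' X :=
  ⟨hX.1, fun Y hY hne hcl => hX.2 Y hY hne fun v hv w hw hvw => hcl v hv w hw (h hvw)⟩

/-- A connected set is left by an edge from each of its nonempty proper subsets. -/
theorem exists_adj (hX : ConnSet G X) (hYX : Y ⊆ X) (hY : Y.Nonempty) (hne : ¬ X ⊆ Y) :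
    ∃ v ∈ Y, ∃ w ∈ X, w ∉ Y ∧ G.Adj v w := by
  by_contra! hcon
  exact hne (hX.2 Y hYX hY fun v hv w hw hvw => by_contra fun hw' => hcon v hv w hw hw' hvw)

theorem iUnion_mem {ι : Sort*} [Nonempty ι] {u : V} {F : ι → Set V} (hF : ∀ i, ConnSet G (F i))
    (hu : ∀ i, u ∈ F i) : ConnSet G (⋃ i, F i) := by
  refine ⟨⟨u, Set.mem_iUnion.2 ⟨Classical.arbitrary ι, hu _⟩⟩, ?_⟩
  rintro Y hY ⟨y, hy⟩ hcl
  have aux : ∀ i, (F i ∩ Y).Nonempty → F i ⊆ Y := by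
    intro i hi
    refine ((hF i).2 (F i ∩ Y) Set.inter_subset_left hi ?_).trans Set.inter_subset_right
    exact fun v hv w hw hvw => ⟨hw, hcl v hv.2 w (Set.mem_iUnion.2 ⟨i, hw⟩) hvw⟩
  obtain ⟨i, hi⟩ := Set.mem_iUnion.1 (hY hy)
  have huY : u ∈ Y := aux i ⟨y, hi, hy⟩ (hu i)
  exact Set.iUnion_subset fun j => aux j ⟨u, hu j, huY⟩

theorem union (hX : ConnSet G X) (hY : ConnSet G Y) (h : (X ∩ Y).Nonempty) :
    ConnSet G (X ∪ Y) := by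
  obtain ⟨u, hu⟩ := h
  rw [Set.union_eq_iUnion]
  exact iUnion_mem (u := u) (by rintro (_ | _) <;> assumption)
    (by rintro (_ | _) <;> [exact hu.2; exact hu.1])

/-- Substituting connected sets for the vertices of a connected set. -/
theorem biUnion {W : Type*} {H : SimpleGraph W} {S : Set W} (hS : ConnSet H S) {F : W → Set V}
    (hF : ∀ b ∈ S, ConnSet G (F b))
    (hadj : ∀ b ∈ S, ∀ b' ∈ S, H.Adj b b' → ∃ u ∈ F b, ∃ v ∈ F b', G.Adj u v) :
    ConnSet G (⋃ b ∈ S, F b) := by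
  obtain ⟨b₀, hb₀⟩ := hS.1
  obtain ⟨u₀, hu₀⟩ := (hF b₀ hb₀).1
  refine ⟨⟨u₀, Set.mem_biUnion hb₀ hu₀⟩, ?_⟩
  rintro Y hY ⟨y, hy⟩ hcl
  have aux : ∀ b ∈ S, (F b ∩ Y).Nonempty → F b ⊆ Y := by
    intro b hb hi
    refine ((hF b hb).2 (F b ∩ Y) Set.inter_subset_left hi ?_).trans Set.inter_subset_right
    exact fun v hv w hw hvw => ⟨hw, hcl v hv.2 w (Set.mem_biUnion hb hw) hvw⟩
  obtain ⟨b, hb, hyb⟩ := Set.mem_iUnion₂.1 (hY hy)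
  have key : S ⊆ {b | b ∈ S ∧ F b ⊆ Y} := by
    refine hS.2 _ (fun b hb => hb.1) ⟨b, hb, aux b hb ⟨y, hyb, hy⟩⟩ ?_
    rintro c ⟨hc, hcY⟩ d hd hcd
    obtain ⟨u, hu, v, hv, huv⟩ := hadj c hc d hd hcd
    exact ⟨hd, aux d hd ⟨v, hv, hcl u (hcY hu) v (Set.mem_biUnion hd hv) huv⟩⟩
  exact Set.iUnion₂_subset fun b hb => (key hb).2

theorem pair {u v : V} (h : G.Adj u v) : ConnSet G {u, v} := by
  refine ⟨⟨u, by simp⟩, ?_⟩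
  rintro Y hY ⟨y, hy⟩ hcl
  have key : u ∈ Y ∧ v ∈ Y := by
    rcases hY hy with rfl | rfl
    · exact ⟨hy, hcl _ hy v (by simp) h⟩
    · exact ⟨hcl _ hy u (by simp) h.symm, hy⟩
  rintro w (rfl | rfl)
  exacts [key.1, key.2]

theorem union_adj (hX : ConnSet G X) (hY : ConnSet G Y) {u v : V} (hu : u ∈ X) (hv : v ∈ Y)
    (h : G.Adj u v) : ConnSet G (X ∪ Y) := by
  have h₁ : ConnSet G (X ∪ {u, v}) := hX.union (pair h) ⟨u, hu, by simp⟩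
  have h₂ := h₁.union hY ⟨v, by simp, hv⟩
  convert h₂ using 1
  ext w
  simp only [Set.mem_union, Set.mem_insert_iff, Set.mem_singleton_iff]
  constructor
  · rintro (h | h) <;> simp [h]
  · rintro ((h | rfl | rfl) | h) <;> simp [*]

theorem insert_adj (hX : ConnSet G X) {u v : V} (hu : u ∈ X) (h : G.Adj u v) :
    ConnSet G (insert v X) := by
  rw [← Set.union_singleton]
  exact hX.union_adj (singleton G v) hu rfl h

theorem image {W : Type*} {H : SimpleGraph W} (f : V → W)
    (hf : ∀ u v, G.Adj u v → H.Adj (f u) (f v)) (hX : ConnSet G X) : ConnSet H (f '' X) := by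
  have := hX.biUnion (G := H) (F := fun v => {f v}) (fun v _ => singleton H _)
    (fun u _ v _ h => ⟨f u, rfl, f v, rfl, hf u v h⟩)
  convert this using 1
  ext w
  simp [eq_comm]

/-- The union of all connected subsets through `v` of a set containing `v` is connected. -/
theorem exists_component (G : SimpleGraph V) {U : Set V} {v : V} (hv : v ∈ U) :
    ∃ C, ConnSet G C ∧ C ⊆ U ∧ v ∈ C ∧ ∀ X, ConnSet G X → X ⊆ U → (X ∩ C).Nonempty → X ⊆ C := by
  let ι := {X : Set V // ConnSet G X ∧ X ⊆ U ∧ v ∈ X}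
  have : Nonempty ι := ⟨⟨{v}, singleton G v, by simpa using hv, rfl⟩⟩
  have hC : ConnSet G (⋃ X : ι, X.1) := iUnion_mem (fun X => X.2.1) fun X => X.2.2.2
  have hCU : (⋃ X : ι, X.1) ⊆ U := Set.iUnion_subset fun X => X.2.2.1
  have hvC : v ∈ ⋃ X : ι, X.1 := Set.mem_iUnion.2 ⟨this.some, this.some.2.2.2⟩
  refine ⟨_, hC, hCU, hvC, fun X hX hXU hne => ?_⟩
  exact Set.subset_union_left.trans (Set.subset_iUnion (fun X : ι => X.1)
    ⟨X ∪ ⋃ X : ι, X.1, hX.union hC hne, Set.union_subset hXU hCU, Or.inr hvC⟩)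

end ConnSet

theorem MinorOf.trans {α β γ : Type*} {F : SimpleGraph α} {H : SimpleGraph β} {G : SimpleGraph γ}
    (h₁ : MinorOf F H) (h₂ : MinorOf H G) : MinorOf F G := by
  rw [minorOf_iff] at *
  obtain ⟨A, hA, hAc, hAa⟩ := h₁
  obtain ⟨B, hB, hBc, hBa⟩ := h₂
  refine ⟨fun a => ⋃ b ∈ A a, B b, ?_, ?_, ?_⟩
  · intro a a' haa'
    simp only [Set.disjoint_iUnion_left, Set.disjoint_iUnion_right]
    intro b hb b' hb'
    exact hB fun h => Set.disjoint_left.1 (hA haa') hb' (h ▸ hb)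
  · exact fun a => (hAc a).biUnion (fun b _ => hBc b) fun b _ b' _ h => hBa b b' h
  · intro a a' h
    obtain ⟨b, hb, b', hb', hbb'⟩ := hAa a a' h
    obtain ⟨u, hu, v, hv, huv⟩ := hBa b b' hbb'
    exact ⟨u, Set.mem_biUnion hb hu, v, Set.mem_biUnion hb' hv, huv⟩

theorem MinorOf.of_injective {α β : Type*} {H : SimpleGraph α} {G : SimpleGraph β} (f : α → β)
    (hf : Function.Injective f) (h : ∀ a b, H.Adj a b → G.Adj (f a) (f b)) : MinorOf H G :=
  minorOf_iff.2 ⟨fun a => {f a}, fun a b hab => by simpa using fun h => hab (hf h),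
    fun a => ConnSet.singleton G _, fun a b hab => ⟨f a, rfl, f b, rfl, h a b hab⟩⟩

/-- The graph joining every element other than `root` to its parent. -/
def parentGraph {ι : Type*} (root : ι) (parent : ι → ι) : SimpleGraph ι :=
  SimpleGraph.fromRel fun i j => i ≠ root ∧ j = parent i

theorem parentGraph_adj_parent {ι : Type*} {root : ι} {parent : ι → ι} {depth : ι → ℕ}
    (h : ∀ i, i ≠ root → depth (parent i) < depth i) {i : ι} (hi : i ≠ root) :
    (parentGraph root parent).Adj i (parent i) := by
  refine (SimpleGraph.fromRel_adj _ _ _).2 ⟨fun h' => ?_, Or.inl ⟨hi, rfl⟩⟩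
  have := h i hi
  rw [← h'] at this
  exact lt_irrefl _ this

theorem parentGraph_isTree {ι : Type*} {root : ι} {parent : ι → ι} {depth : ι → ℕ}
    (h : ∀ i, i ≠ root → depth (parent i) < depth i) : (parentGraph root parent).IsTree := by
  have hreach : ∀ n i, depth i ≤ n → (parentGraph root parent).Reachable i root := by
    intro n
    induction n with
    | zero =>
      intro i hi
      by_cases hr : i = root
      · rw [hr]
      · have := h i hr
        omega
    | succ n ih =>
      intro i hi
      by_cases hr : i = root
      · rw [hr]
      · have := h i hr
        exact (parentGraph_adj_parent h hr).reachable.trans (ih _ (by omega))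
  refine ⟨?_, ?_⟩
  · rw [connected_iff_exists_forall_reachable]
    exact ⟨root, fun i => (hreach _ i le_rfl).symm⟩
  · classical
    intro v c hc
    obtain ⟨m, hm, hmax⟩ := c.support.toFinset.exists_max_image depth ⟨v, by simp⟩
    simp only [List.mem_toFinset] at hm hmax
    have hpar : ∀ w, (parentGraph root parent).Adj m w → w ∈ c.support → w = parent m := by
      intro w hw hwc
      rcases ((SimpleGraph.fromRel_adj _ _ _).1 hw).2 with ⟨_, h'⟩ | ⟨hr, h'⟩
      · exact h'
      · have h₁ := h w hr
        have h₂ := hmax w hwc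
        rw [← h'] at h₁
        omega
    have hc' := hc.rotate hm
    have hsub : ∀ w, w ∈ (c.rotate m hm).support → w ∈ c.support := fun w hw =>
      (c.mem_support_rotate_iff _ hm).1 hw
    refine hc'.snd_ne_penultimate ?_
    rw [hpar _ (Walk.adj_snd hc'.not_nil) (hsub _ (Walk.getVert_mem_support _ _)),
      hpar _ (Walk.adj_penultimate hc'.not_nil).symm (hsub _ (Walk.getVert_mem_support _ _))]

/-- A rooted tree decomposition of `G[U]` with bags of size at most `w` whose root bag
contains `W`. -/
structure RootedDecomp {V : Type} (G : SimpleGraph V) (U W : Finset V) (w : ℕ) where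
  ι : Type
  root : ι
  parent : ι → ι
  depth : ι → ℕ
  bag : ι → Finset V
  depth_parent : ∀ i, i ≠ root → depth (parent i) < depth i
  bag_subset : ∀ i, bag i ⊆ U
  card_bag_le : ∀ i, (bag i).card ≤ w
  subset_root : W ⊆ bag root
  exists_top : ∀ v ∈ U, ∃ t, v ∈ bag t ∧
    ∀ i, v ∈ bag i → i = t ∨ (i ≠ root ∧ v ∈ bag (parent i))
  exists_bag : ∀ u ∈ U, ∀ v ∈ U, G.Adj u v → ∃ i, u ∈ bag i ∧ v ∈ bag i

namespace RootedDecomp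

variable {V : Type} {G : SimpleGraph V}

/-- The decomposition with a single bag. -/
def single (G : SimpleGraph V) (U W : Finset V) (w : ℕ) (hW : W ⊆ U) (hU : U.card ≤ w) :
    RootedDecomp G U W w where
  ι := Unit
  root := ()
  parent := id
  depth := 0
  bag := fun _ => U
  depth_parent := fun _ hi => absurd rfl hi
  bag_subset := fun _ => subset_rfl
  card_bag_le := fun _ => hU
  subset_root := hW
  exists_top := fun _ hv => ⟨(), hv, fun _ _ => Or.inl rfl⟩
  exists_bag := fun _ hu _ hv _ => ⟨(), hu, hv⟩

theorem root_of_top {U W : Finset V} {w : ℕ} (D : RootedDecomp G U W w) {v : V} {t : D.ι}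
    (ht : ∀ i, v ∈ D.bag i → i = t ∨ (i ≠ D.root ∧ v ∈ D.bag (D.parent i)))
    (hv : v ∈ D.bag D.root) : t = D.root := by
  rcases ht _ hv with h | ⟨h, -⟩
  · exact h.symm
  · exact absurd rfl h

/-- Attaching decompositions of the pieces `U' k` below a root bag `R`. -/
theorem nonempty_glue [DecidableEq V] {κ : Type} {R U W : Finset V} {w : ℕ} {U' W' : κ → Finset V}
    (D : ∀ k, RootedDecomp G (U' k) (W' k) w) (hR : R.card ≤ w) (hW : W ⊆ R) (hRU : R ⊆ U)
    (hU' : ∀ k, U' k ⊆ U) (hcover : ∀ v ∈ U, v ∈ R ∨ ∃ k, v ∈ U' k)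
    (hinter : ∀ k, U' k ∩ R ⊆ W' k)
    (hdisj : ∀ k l v, v ∈ U' k → v ∈ U' l → v ∉ R → k = l)
    (hadj : ∀ u ∈ U, ∀ v ∈ U, G.Adj u v → (u ∈ R ∧ v ∈ R) ∨ ∃ k, u ∈ U' k ∧ v ∈ U' k) :
    Nonempty (RootedDecomp G U W w) := by
  classical
  refine ⟨
    { ι := Option (Σ k, (D k).ι)
      root := none
      parent := fun i => i.elim none fun x =>
        if x.2 = (D x.1).root then none else some ⟨x.1, (D x.1).parent x.2⟩
      depth := fun i => i.elim 0 fun x => (D x.1).depth x.2 + 1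
      bag := fun i => i.elim R fun x => (D x.1).bag x.2
      depth_parent := ?_
      bag_subset := ?_
      card_bag_le := ?_
      subset_root := hW
      exists_top := ?_
      exists_bag := ?_ }⟩
  · rintro (_ | ⟨k, x⟩) hi
    · exact absurd rfl hi
    · dsimp only [Option.elim]
      split_ifs with h
      · simp
      · simpa using (D k).depth_parent x h
  · rintro (_ | ⟨k, x⟩)
    · exact hRU
    · exact ((D k).bag_subset x).trans (hU' k)
  · rintro (_ | ⟨k, x⟩)
    · exact hR
    · exact (D k).card_bag_le x
  · intro v hv
    by_cases hvR : v ∈ R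
    · refine ⟨none, hvR, ?_⟩
      rintro (_ | ⟨k, x⟩) hx
      · exact Or.inl rfl
      · refine Or.inr ⟨by simp, ?_⟩
        dsimp only [Option.elim] at hx ⊢
        have hvk : v ∈ U' k := (D k).bag_subset x hx
        split_ifs with h
        · exact hvR
        · obtain ⟨t, -, ht⟩ := (D k).exists_top v hvk
          have hroot := (D k).root_of_top ht
            ((D k).subset_root (hinter k (Finset.mem_inter.2 ⟨hvk, hvR⟩)))
          rcases ht x hx with h' | ⟨-, h'⟩
          · exact absurd (h'.trans hroot) h
          · exact h'
    · obtain ⟨k, hk⟩ := (hcover v hv).resolve_left hvR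
      obtain ⟨t, htv, ht⟩ := (D k).exists_top v hk
      refine ⟨some ⟨k, t⟩, htv, ?_⟩
      rintro (_ | ⟨l, x⟩) hx
      · exact absurd hx hvR
      · dsimp only [Option.elim] at hx ⊢
        obtain rfl := hdisj l k v ((D l).bag_subset x hx) hk hvR
        rcases ht x hx with rfl | ⟨h, h'⟩
        · exact Or.inl rfl
        · refine Or.inr ⟨by simp, ?_⟩
          rw [if_neg h]
          exact h'
  · intro u hu v hv huv
    rcases hadj u hu v hv huv with h | ⟨k, hk, hk'⟩
    · exact ⟨none, h⟩
    · obtain ⟨i, hi⟩ := (D k).exists_bag u hk v hk' huv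
      exact ⟨some ⟨k, i⟩, hi⟩

theorem treewidth_le [Fintype V] {W : Finset V} {w : ℕ}
    (D : RootedDecomp G Finset.univ W w) : treewidth G ≤ w := by
  let td : TreeDecomp G :=
    { ι := D.ι
      tree := parentGraph D.root D.parent
      isTree := parentGraph_isTree D.depth_parent
      bag := D.bag
      mem_bag := fun v => by
        obtain ⟨t, ht, -⟩ := D.exists_top v (Finset.mem_univ v)
        exact ⟨t, ht⟩
      adj_bag := fun u v h => D.exists_bag u (Finset.mem_univ u) v (Finset.mem_univ v) h
      connected_bag := fun v => by
        obtain ⟨t, ht, htop⟩ := D.exists_top v (Finset.mem_univ v)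
        have hreach : ∀ n i (hi : i ∈ {i | v ∈ D.bag i}), D.depth i ≤ n →
            ((parentGraph D.root D.parent).induce {i | v ∈ D.bag i}).Reachable ⟨t, ht⟩ ⟨i, hi⟩ := by
          intro n
          induction n with
          | zero =>
            intro i hi hn
            rcases htop i hi with rfl | ⟨hr, -⟩
            · exact Reachable.refl _
            · have := D.depth_parent i hr
              omega
          | succ n ih =>
            intro i hi hn
            rcases htop i hi with rfl | ⟨hr, hp⟩
            · exact Reachable.refl _
            · have := D.depth_parent i hr
              refine (ih _ hp (by omega)).trans (Adj.reachable ?_)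
              simpa using (parentGraph_adj_parent D.depth_parent hr).symm
        rw [connected_iff_exists_forall_reachable]
        exact ⟨⟨t, ht⟩, fun ⟨i, hi⟩ => hreach _ i hi le_rfl⟩ }
  calc treewidth G ≤ td.width := Nat.sInf_le ⟨td, rfl⟩
    _ ≤ w := by
      refine (Nat.sub_le _ _).trans (csSup_le' ?_)
      rintro n ⟨i, rfl⟩
      exact D.card_bag_le i

end RootedDecomp

/-- A large-order family of connected sets, any two of which intersect, exists in every graph of
large treewidth. -/
theorem exists_intersecting_bramble {V : Type} [Fintype V] (G : SimpleGraph V) (k : ℕ)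
    (hk : 4 * k < treewidth G) :
    ∃ 𝓑 : Set (Set V), (∀ X ∈ 𝓑, ConnSet G X) ∧ (∀ X ∈ 𝓑, ∀ Y ∈ 𝓑, (X ∩ Y).Nonempty) ∧
      ∀ S : Finset V, (∀ X ∈ 𝓑, ∃ v ∈ S, v ∈ X) → k ≤ S.card := by
  classical
  by_contra hcon
  have hsep : ∀ W : Finset V, ∃ S : Finset V, S.card < k ∧ ∀ C : Finset V, ConnSet G (C : Set V) →
      Disjoint S C → 2 * (C ∩ W).card ≤ W.card := by
    intro W
    by_contra! hW
    refine hcon ⟨{X | ConnSet G X ∧ ∃ C : Finset V, X = C ∧ W.card < 2 * (C ∩ W).card},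
      fun X hX => hX.1, ?_, ?_⟩
    · rintro _ ⟨-, C, rfl, hC⟩ _ ⟨-, C', rfl, hC'⟩
      by_contra hne
      rw [← Finset.coe_inter, Finset.coe_nonempty, Finset.not_nonempty_iff_eq_empty,
        ← Finset.disjoint_iff_inter_eq_empty] at hne
      have hd : Disjoint (C ∩ W) (C' ∩ W) :=
        hne.mono Finset.inter_subset_left Finset.inter_subset_left
      have := Finset.card_le_card (Finset.union_subset (s := C ∩ W) (t := C' ∩ W)
        Finset.inter_subset_right Finset.inter_subset_right)
      rw [Finset.card_union_of_disjoint hd] at this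
      omega
    · intro S hS
      by_contra! hlt
      obtain ⟨C, hC, hSC, hCW⟩ := hW S hlt
      obtain ⟨v, hvS, hvC⟩ := hS C ⟨hC, C, rfl, hCW⟩
      exact Finset.disjoint_left.1 hSC hvS hvC
  have main : ∀ n, ∀ U W : Finset V, U.card ≤ n → W ⊆ U → W.card ≤ 3 * k →
      Nonempty (RootedDecomp G U W (4 * k)) := by
    intro n
    induction n with
    | zero =>
      intro U W hU hWU _
      exact ⟨.single G U W _ hWU (by omega)⟩
    | succ n ih =>
      intro U W hU hWU hW
      by_cases hUk : U.card ≤ 4 * k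
      · exact ⟨.single G U W _ hWU hUk⟩
      obtain ⟨W₁, hWW₁, hW₁U, hW₁⟩ := Finset.exists_subsuperset_card_eq hWU hW (by omega)
      obtain ⟨S, hS, hSC⟩ := hsep W₁
      let κ := {C : Finset V // ConnSet G (C : Set V) ∧ C ⊆ U \ S ∧
        ∀ X : Set V, ConnSet G X → X ⊆ ((U \ S : Finset V) : Set V) → (X ∩ C).Nonempty → X ⊆ C}
      have hbal : ∀ C : κ, 2 * (C.1 ∩ W₁).card ≤ 3 * k := by
        intro C
        rw [← hW₁]
        refine hSC C.1 C.2.1 ?_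
        rw [Finset.disjoint_right]
        exact fun v hv => (Finset.mem_sdiff.1 (C.2.2.1 hv)).2
      have hcomp : ∀ v ∈ U \ S, ∃ C : κ, v ∈ C.1 := by
        intro v hv
        obtain ⟨C, hC, hCU, hvC, hmax⟩ := ConnSet.exists_component G
          (U := ((U \ S : Finset V) : Set V)) (Finset.mem_coe.2 hv)
        have hfin : (C.toFinset : Set V) = C := Set.coe_toFinset C
        refine ⟨⟨C.toFinset, ?_, ?_, ?_⟩, by simpa using hvC⟩
        · rwa [hfin]
        · rw [← Finset.coe_subset, hfin]
          exact hCU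
        · rwa [hfin]
      have hmeet : ∀ C C' : κ, ∀ v, v ∈ C.1 → v ∈ C'.1 → C = C' := by
        intro C C' v hv hv'
        apply Subtype.ext
        apply Finset.Subset.antisymm
        · exact Finset.coe_subset.1 (C'.2.2.2 C.1 C.2.1 (Finset.coe_subset.2 C.2.2.1) ⟨v, hv, hv'⟩)
        · exact Finset.coe_subset.1 (C.2.2.2 C'.1 C'.2.1 (Finset.coe_subset.2 C'.2.2.1) ⟨v, hv', hv⟩)
      have hsub : ∀ C : κ, C.1 ∪ S ∩ U ⊆ U := fun C =>
        Finset.union_subset (C.2.2.1.trans Finset.sdiff_subset) Finset.inter_subset_right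
      have hD : ∀ C : κ,
          Nonempty (RootedDecomp G (C.1 ∪ S ∩ U) ((C.1 ∩ W₁) ∪ S ∩ U) (4 * k)) := by
        intro C
        apply ih
        · have hlt : (C.1 ∪ S ∩ U).card < U.card := by
            apply Finset.card_lt_card
            refine Finset.ssubset_iff_subset_ne.2 ⟨hsub C, fun heq => ?_⟩
            have h₁ : W₁ ⊆ (C.1 ∩ W₁) ∪ S := by
              intro v hv
              have := hW₁U hv
              rw [← heq] at this
              simp only [Finset.mem_union, Finset.mem_inter] at this ⊢
              tauto
            have h₂ := (Finset.card_le_card h₁).trans (Finset.card_union_le _ _)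
            have := hbal C
            omega
          omega
        · exact Finset.union_subset_union_left Finset.inter_subset_left
        · have h₁ := Finset.card_union_le (C.1 ∩ W₁) (S ∩ U)
          have h₂ := Finset.card_le_card (Finset.inter_subset_left (s₁ := S) (s₂ := U))
          have := hbal C
          omega
      refine RootedDecomp.nonempty_glue (R := W₁ ∪ S ∩ U) (fun C : κ => (hD C).some) ?_ ?_ ?_
        hsub ?_ ?_ ?_ ?_
      · have h₁ := Finset.card_union_le W₁ (S ∩ U)
        have h₂ := Finset.card_le_card (Finset.inter_subset_left (s₁ := S) (s₂ := U))
        omega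
      · exact hWW₁.trans Finset.subset_union_left
      · exact Finset.union_subset hW₁U Finset.inter_subset_right
      · intro v hv
        by_cases hvS : v ∈ S
        · exact Or.inl (by simp [hvS, hv])
        · obtain ⟨C, hC⟩ := hcomp v (by simp [hvS, hv])
          exact Or.inr ⟨C, by simp [hC]⟩
      · intro C v
        simp only [Finset.mem_union, Finset.mem_inter]
        tauto
      · intro C C' v hv hv' hvR
        simp only [Finset.mem_union, Finset.mem_inter] at hv hv' hvR
        exact hmeet C C' v (by tauto) (by tauto)
      · intro u hu v hv huv
        by_cases huS : u ∈ S
        · by_cases hvS : v ∈ S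
          · exact Or.inl (by simp [*])
          · obtain ⟨C, hC⟩ := hcomp v (by simp [hvS, hv])
            exact Or.inr ⟨C, by simp [*]⟩
        · obtain ⟨C, hC⟩ := hcomp u (by simp [huS, hu])
          refine Or.inr ⟨C, by simp [hC], ?_⟩
          by_cases hvS : v ∈ S
          · simp [hvS, hv]
          · have := C.2.2.2 {u, v} (ConnSet.pair huv)
              (by rintro w (rfl | rfl) <;> simp [*]) ⟨u, by simp, hC⟩
            exact Finset.mem_union_left _ (this (by simp))
  obtain ⟨D⟩ := main _ Finset.univ ∅ le_rfl (Finset.empty_subset _) (by simp)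
  exact absurd D.treewidth_le (by omega)

/-- The family `𝓕` cannot be hit by fewer than `k` vertices. -/
def OrderAtLeast {V : Type*} (𝓕 : Set (Set V)) (k : ℕ) : Prop :=
  ∀ S : Finset V, (∀ X ∈ 𝓕, ∃ v ∈ S, v ∈ X) → k ≤ S.card

/-- A connected set such that the members of `𝓑` meeting it form a family of order exactly `k`. -/
theorem exists_connSet_order_eq {V : Type*} [Finite V] {G : SimpleGraph V} {𝓑 : Set (Set V)}
    (hconn : ∀ X ∈ 𝓑, ConnSet G X) (hinter : ∀ X ∈ 𝓑, ∀ Y ∈ 𝓑, (X ∩ Y).Nonempty) {k : ℕ}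
    (hk : 1 ≤ k) (hord : OrderAtLeast 𝓑 k) :
    ∃ P : Set V, ConnSet G P ∧ P ⊆ ⋃₀ 𝓑 ∧ OrderAtLeast {X ∈ 𝓑 | (X ∩ P).Nonempty} k ∧
      ∃ T : Finset V, T.card ≤ k ∧ ∀ X ∈ 𝓑, (X ∩ P).Nonempty → ∃ v ∈ T, v ∈ X := by
  classical
  have hne : 𝓑.Nonempty := by
    by_contra h
    rw [Set.not_nonempty_iff_eq_empty] at h
    have := hord ∅ (by simp [h])
    simp at this
    omega
  obtain ⟨X₀, hX₀⟩ := hne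
  obtain ⟨v₀, hv₀⟩ := (hconn X₀ hX₀).1
  let good : Set (Set V) := {P | ConnSet G P ∧ P ⊆ ⋃₀ 𝓑 ∧
    ∃ T : Finset V, T.card ≤ k ∧ ∀ X ∈ 𝓑, (X ∩ P).Nonempty → ∃ v ∈ T, v ∈ X}
  have hgood : good.Nonempty := by
    refine ⟨{v₀}, ConnSet.singleton G v₀, ?_, {v₀}, by simpa using hk, ?_⟩
    · simpa using ⟨X₀, hX₀, hv₀⟩
    · rintro X - ⟨v, hv, rfl⟩
      exact ⟨v, by simp, hv⟩
  obtain ⟨P, hP⟩ := (Set.toFinite good).exists_maximal hgood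
  obtain ⟨⟨hPc, hPB, T, hT, hTP⟩, hmax⟩ := hP
  refine ⟨P, hPc, hPB, ?_, T, hT, hTP⟩
  intro S hS
  by_contra! hlt
  have hU : ConnSet G (⋃₀ 𝓑) := by
    refine ⟨⟨v₀, X₀, hX₀, hv₀⟩, ?_⟩
    rintro Y hY ⟨y, hy⟩ hcl
    have aux : ∀ X ∈ 𝓑, (X ∩ Y).Nonempty → X ⊆ Y := by
      intro X hX hi
      refine ((hconn X hX).2 (X ∩ Y) Set.inter_subset_left hi ?_).trans Set.inter_subset_right
      exact fun v hv w hw hvw => ⟨hw, hcl v hv.2 w ⟨X, hX, hw⟩ hvw⟩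
    obtain ⟨Z, hZ, hyZ⟩ := hY hy
    rintro v ⟨X, hX, hv⟩
    obtain ⟨z, hz⟩ := hinter X hX Z hZ
    exact aux X hX ⟨z, hz.1, aux Z hZ ⟨y, hyZ, hy⟩ hz.2⟩ hv
  by_cases hsub : ⋃₀ 𝓑 ⊆ P
  · have := hord S fun X hX => hS X ⟨hX, by
      obtain ⟨x, hx⟩ := (hconn X hX).1
      exact ⟨x, hx, hsub ⟨X, hX, hx⟩⟩⟩
    omega
  · obtain ⟨v, hv, w, hw, hwP, hvw⟩ := hU.exists_adj hPB hPc.1 hsub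
    refine hwP (hmax (y := insert w P) ⟨hPc.insert_adj hv hvw, Set.insert_subset hw hPB,
      insert w S, ?_, ?_⟩ (Set.subset_insert w P) (Set.mem_insert w P))
    · exact (Finset.card_insert_le _ _).trans hlt
    · rintro X hX ⟨x, hxX, rfl | hxP⟩
      · exact ⟨x, by simp, hxX⟩
      · obtain ⟨s, hs, hsX⟩ := hS X ⟨hX, x, hxX, hxP⟩
        exact ⟨s, by simp [hs], hsX⟩

/-- Splitting an intersecting family of order `n * k` along `n` disjoint connected sets. -/
theorem exists_disjoint_connSets {V : Type*} [Finite V] {G : SimpleGraph V} {k : ℕ} (hk : 1 ≤ k) :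
    ∀ (n : ℕ) (𝓑 : Set (Set V)), (∀ X ∈ 𝓑, ConnSet G X) →
      (∀ X ∈ 𝓑, ∀ Y ∈ 𝓑, (X ∩ Y).Nonempty) → OrderAtLeast 𝓑 (n * k) →
      ∃ P : Fin n → Set V, (∀ i, ConnSet G (P i)) ∧ (∀ i, P i ⊆ ⋃₀ 𝓑) ∧
        (Pairwise fun i j => Disjoint (P i) (P j)) ∧
        ∀ i, OrderAtLeast {X ∈ 𝓑 | (X ∩ P i).Nonempty} k := by
  classical
  intro n
  induction n with
  | zero =>
    intro 𝓑 _ _ _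
    exact ⟨Fin.elim0, fun i => i.elim0, fun i => i.elim0, fun i => i.elim0, fun i => i.elim0⟩
  | succ n ih =>
    intro 𝓑 hconn hinter hord
    obtain ⟨P₀, hP₀, hP₀B, hP₀k, T, hT, hTP⟩ := exists_connSet_order_eq hconn hinter hk
      fun S hS => (Nat.le_mul_of_pos_left k n.succ_pos).trans (hord S hS)
    obtain ⟨P, hP, hPB, hPd, hPk⟩ := ih {X ∈ 𝓑 | Disjoint X P₀} (fun X hX => hconn X hX.1)
      (fun X hX Y hY => hinter X hX.1 Y hY.1) (by
        intro S hS
        have h₁ := hord (T ∪ S) fun X hX => by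
          by_cases h : Disjoint X P₀
          · obtain ⟨v, hv, hvX⟩ := hS X ⟨hX, h⟩
            exact ⟨v, by simp [hv], hvX⟩
          · obtain ⟨v, hv, hvX⟩ := hTP X hX (Set.not_disjoint_iff_nonempty_inter.1 h)
            exact ⟨v, by simp [hv], hvX⟩
        have h₂ := Finset.card_union_le T S
        rw [Nat.succ_mul] at h₁
        omega)
    have hd : ∀ i, Disjoint P₀ (P i) := by
      intro i
      rw [Set.disjoint_left]
      intro v hv hvi
      obtain ⟨X, hX, hvX⟩ := hPB i hvi
      exact Set.disjoint_left.1 hX.2 hvX hv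
    refine ⟨Fin.cons P₀ P, ?_, ?_, ?_, ?_⟩
    · exact Fin.cases hP₀ hP
    · exact Fin.cases hP₀B fun i => (hPB i).trans (Set.sUnion_mono fun X hX => hX.1)
    · intro i j
      induction i using Fin.cases with
      | zero =>
        induction j using Fin.cases with
        | zero => exact fun h => absurd rfl h
        | succ j => exact fun _ => by simpa using hd j
      | succ i =>
        induction j using Fin.cases with
        | zero => exact fun _ => by simpa using (hd i).symm
        | succ j => exact fun h => by simpa using hPd fun h' => h (congrArg _ h')
    · refine Fin.cases hP₀k fun i S hS => hPk i S fun X hX => hS X ⟨hX.1.1, ?_⟩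
      simpa using hX.2

/-- Every vertex set meeting all connected sets between `A` and `B` has at least `k` elements. -/
def SeparatorsAtLeast {V : Type*} (G : SimpleGraph V) (A B : Set V) (k : ℕ) : Prop :=
  OrderAtLeast {X | ConnSet G X ∧ (X ∩ A).Nonempty ∧ (X ∩ B).Nonempty} k

/-- There are `k` disjoint connected sets, each meeting both `A` and `B`. -/
def HasLinkage {V : Type*} (G : SimpleGraph V) (A B : Set V) (k : ℕ) : Prop :=
  ∃ Q : Fin k → Set V, (Pairwise fun i j => Disjoint (Q i) (Q j)) ∧ (∀ i, ConnSet G (Q i)) ∧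
    (∀ i, (Q i ∩ A).Nonempty) ∧ ∀ i, (Q i ∩ B).Nonempty

/-- The edges of `G` with an endpoint in `D`. -/
def edgesMeeting {V : Type*} (G : SimpleGraph V) (D : Set V) : SimpleGraph V where
  Adj u v := G.Adj u v ∧ (u ∈ D ∨ v ∈ D)
  symm := ⟨fun _ _ h => ⟨h.1.symm, h.2.symm⟩⟩
  loopless := ⟨fun _ h => G.loopless.irrefl _ h.1⟩

theorem linkage_to_separator {V : Type*} {G G' : SimpleGraph V} {A B D : Set V} {S : Finset V}
    {x y : V} {k : ℕ} (hG : G' ≤ G)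
    (hG' : ∀ u v, G.Adj u v → G'.Adj u v ∨ (u = x ∧ v = y) ∨ (u = y ∧ v = x))
    (hAD : ∀ a ∈ A, a ∈ D ∨ a ∈ S) (hD : ∀ v ∈ D, ∀ w, G'.Adj v w → w ∈ D ∨ w ∈ S)
    (hy : y ∉ D) (hDB : Disjoint D B) (hS : S.card < k)
    (hsep : SeparatorsAtLeast G A B k)
    (ih : ∀ C k, SeparatorsAtLeast (edgesMeeting G' D) A C k →
      HasLinkage (edgesMeeting G' D) A C k) :
    ∃ Q : Option S → Set V, (Pairwise fun i j => Disjoint (Q i) (Q j)) ∧ (∀ i, ConnSet G (Q i)) ∧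
      (∀ i, (Q i ∩ A).Nonempty) ∧ (∀ i, i.elim x (↑) ∈ Q i) ∧ (∀ i, Q i ⊆ D ∪ S) ∧
      Fintype.card (Option S) = k := by
  classical
  let pt : Option S → V := fun i => i.elim x (↑)
  have hGD : edgesMeeting G' D ≤ G := fun u v h => hG h.1
  obtain ⟨Q, hQd, hQc, hQA, hQC⟩ := ih (Set.range pt) k (by
    intro T hT
    refine hsep T ?_
    rintro Z ⟨hZ, ⟨a, haZ, haA⟩, b, hbZ, hbB⟩
    by_contra! hZT
    have hTX : ∀ X, ConnSet (edgesMeeting G' D) X → X ⊆ Z → (X ∩ A).Nonempty →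
        Disjoint X (Set.range pt) := by
      intro X hX hXZ hXA
      by_contra hd
      obtain ⟨v, hvT, hvX⟩ := hT X ⟨hX, hXA, Set.not_disjoint_iff_nonempty_inter.1 hd⟩
      exact hZT v hvT (hXZ hvX)
    obtain ⟨K, hK, hKZ, haK, hKmax⟩ := ConnSet.exists_component (edgesMeeting G' D) haZ
    have hKd := Set.disjoint_left.1 (hTX K hK hKZ ⟨a, haK, haA⟩)
    have hKS : ∀ v ∈ K, v ∉ S := fun v hv hvS => hKd hv ⟨some ⟨v, hvS⟩, rfl⟩
    have hKx : ∀ v ∈ K, v ≠ x := fun v hv h => hKd hv ⟨none, h.symm⟩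
    have hKD : K ⊆ K ∩ D := by
      refine hK.2 _ Set.inter_subset_left ⟨a, haK, (hAD a haA).resolve_right (hKS a haK)⟩ ?_
      exact fun v hv w hw hvw => ⟨hw, (hD v hv.2 w hvw.1).resolve_right (hKS w hw)⟩
    have hZK : Z ⊆ K := by
      refine hZ.2 K hKZ ⟨a, haK⟩ fun v hv w hw hvw => ?_
      have hvD := (hKD hv).2
      rcases hG' v w hvw with h | ⟨h, -⟩ | ⟨h, -⟩
      · exact hKmax {v, w} (ConnSet.pair ⟨h, Or.inl hvD⟩)
          (by rintro u (rfl | rfl) <;> [exact hKZ hv; exact hw]) ⟨v, by simp, hv⟩ (by simp)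
      · exact absurd h (hKx v hv)
      · exact absurd (h ▸ hvD) hy
    exact Set.disjoint_left.1 hDB (hKD (hZK hbZ)).2 hbB)
  have hg : ∀ i, ∃ o, pt o ∈ Q i := fun i => by
    obtain ⟨v, hv, o, rfl⟩ := hQC i
    exact ⟨o, hv⟩
  choose g hg using hg
  have hginj : Function.Injective g := by
    intro i j hij
    by_contra hne
    exact Set.disjoint_left.1 (hQd hne) (hg i) (hij ▸ hg j)
  have hcard : Fintype.card (Option S) = k := by
    have h₁ := Fintype.card_le_of_injective g hginj
    simp only [Fintype.card_fin, Fintype.card_option, Fintype.card_coe] at h₁ ⊢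
    omega
  have hgbij : Function.Bijective g :=
    (Fintype.bijective_iff_injective_and_card g).2 ⟨hginj, by simp [hcard]⟩
  let e := Equiv.ofBijective g hgbij
  have he : ∀ i, pt i ∈ Q (e.symm i) := fun i => by
    have := hg (e.symm i)
    rwa [show g (e.symm i) = i from e.apply_symm_apply i] at this
  refine ⟨fun i => Q (e.symm i), fun i j hij => hQd fun h => hij (e.symm.injective h),
    fun i => (hQc _).mono hGD, fun i => hQA _, he, fun i => ?_, hcard⟩
  obtain ⟨a, ha, haA⟩ := hQA (e.symm i)
  refine ((hQc (e.symm i)).2 (Q (e.symm i) ∩ (D ∪ S)) Set.inter_subset_left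
    ⟨a, ha, hAD a haA⟩ ?_).trans Set.inter_subset_right
  rintro v - w hw ⟨hvw, hv | hv⟩
  · exact ⟨hw, hD v hv w hvw⟩
  · exact ⟨hw, Or.inl hv⟩

theorem SeparatorsAtLeast.symm {V : Type*} {G : SimpleGraph V} {A B : Set V} {k : ℕ}
    (h : SeparatorsAtLeast G A B k) : SeparatorsAtLeast G B A k :=
  fun S hS => h S fun X hX => hS X ⟨hX.1, hX.2.2, hX.2.1⟩

/-- **Menger's theorem**, for connected sets in place of paths. -/
theorem hasLinkage_of_separatorsAtLeast {V : Type*} [Finite V] (G : SimpleGraph V) :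
    ∀ (A B : Set V) (k : ℕ), SeparatorsAtLeast G A B k → HasLinkage G A B k := by
  classical
  induction G using WellFoundedLT.induction with
  | ind G ih =>
  intro A B k hsep
  by_cases hE : ∃ x y, G.Adj x y
  swap
  · push Not at hE
    have hfin : (A ∩ B).Finite := Set.toFinite _
    have hk : k ≤ hfin.toFinset.card := by
      refine hsep _ ?_
      rintro X ⟨hX, ⟨a, haX, haA⟩, b, hbX, hbB⟩
      have hXa := hX.2 {a} (by simpa using haX) ⟨a, rfl⟩ fun v _ w _ h => absurd h (hE v w)
      have hba : b = a := hXa hbX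
      exact ⟨a, by simpa using ⟨haA, hba ▸ hbB⟩, haX⟩
    obtain ⟨f⟩ : Nonempty (Fin k ↪ hfin.toFinset) :=
      Function.Embedding.nonempty_of_card_le (by simpa using hk)
    refine ⟨fun i => {(f i : V)}, fun i j hij => ?_, fun i => ConnSet.singleton G _, fun i => ?_,
      fun i => ?_⟩
    · simpa using fun h => hij (f.injective (Subtype.ext h))
    · exact ⟨f i, rfl, (hfin.mem_toFinset.1 (f i).2).1⟩
    · exact ⟨f i, rfl, (hfin.mem_toFinset.1 (f i).2).2⟩
  obtain ⟨x, y, hxy⟩ := hE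
  have hlt : G.deleteEdges {s(x, y)} < G := by
    refine lt_of_le_of_ne (deleteEdges_le _) fun h => ?_
    rw [← h] at hxy
    simp at hxy
  by_cases hsep' : SeparatorsAtLeast (G.deleteEdges {s(x, y)}) A B k
  · obtain ⟨Q, hQd, hQc, hQ⟩ := ih _ hlt A B k hsep'
    exact ⟨Q, hQd, fun i => (hQc i).mono hlt.le, hQ⟩
  unfold SeparatorsAtLeast OrderAtLeast at hsep'
  push Not at hsep'
  obtain ⟨S, hS, hSk⟩ := hsep'
  set G' := G.deleteEdges {s(x, y)} with hG'def
  have hG' : ∀ u v, G.Adj u v → G'.Adj u v ∨ (u = x ∧ v = y) ∨ (u = y ∧ v = x) := by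
    intro u v huv
    simp only [hG'def, deleteEdges_adj, Set.mem_singleton_iff, Sym2.eq_iff]
    tauto
  let reach : Set V → Set V := fun A =>
    {v | ∃ X, ConnSet G' X ∧ (X ∩ A).Nonempty ∧ v ∈ X ∧ ∀ s ∈ S, s ∉ X}
  have hmem : ∀ A : Set V, ∀ a ∈ A, a ∈ reach A ∨ a ∈ S := by
    intro A a ha
    by_cases haS : a ∈ S
    · exact Or.inr haS
    · exact Or.inl ⟨{a}, ConnSet.singleton _ a, ⟨a, rfl, ha⟩, rfl,
        fun s hs h => haS (Set.mem_singleton_iff.1 h ▸ hs)⟩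
  have hcl : ∀ A : Set V, ∀ v ∈ reach A, ∀ w, G'.Adj v w → w ∈ reach A ∨ w ∈ S := by
    rintro A v ⟨X, hX, hXA, hvX, hXS⟩ w hvw
    by_cases hw : w ∈ S
    · exact Or.inr hw
    · refine Or.inl ⟨insert w X, hX.insert_adj hvX hvw, hXA.mono
        (Set.inter_subset_inter_left _ (Set.subset_insert _ _)), Set.mem_insert _ _, ?_⟩
      rintro s hs (rfl | h)
      exacts [hw hs, hXS s hs h]
  have hnS : ∀ A : Set V, ∀ v ∈ reach A, v ∉ S := by
    rintro A v ⟨X, -, -, hvX, hXS⟩ hv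
    exact hXS v hv hvX
  have hdisj : Disjoint (reach A) (reach B) := by
    rw [Set.disjoint_left]
    rintro v ⟨X, hX, hXA, hvX, hXS⟩ ⟨Y, hY, hYB, hvY, hYS⟩
    obtain ⟨s, hs, h | h⟩ := hS (X ∪ Y) ⟨hX.union hY ⟨v, hvX, hvY⟩,
      hXA.mono (Set.inter_subset_inter_left _ Set.subset_union_left),
      hYB.mono (Set.inter_subset_inter_left _ Set.subset_union_right)⟩
    exacts [hXS s hs h, hYS s hs h]
  obtain ⟨Z, hZ, hZS⟩ : ∃ Z, (ConnSet G Z ∧ (Z ∩ A).Nonempty ∧ (Z ∩ B).Nonempty) ∧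
      ∀ s ∈ S, s ∉ Z := by
    by_contra! hcon
    exact absurd (hsep S hcon) (by omega)
  have hcross : ∀ A B : Set V, (Z ∩ A).Nonempty → (Z ∩ B).Nonempty →
      Disjoint (reach A) (reach B) → ∃ v ∈ reach A, ∃ w ∉ reach A,
        (v = x ∧ w = y) ∨ (v = y ∧ w = x) := by
    rintro A B ⟨a, haZ, haA⟩ ⟨b, hbZ, hbB⟩ hd
    obtain ⟨v, hv, w, hw, hwn, hvw⟩ := hZ.1.exists_adj (Y := Z ∩ reach A) Set.inter_subset_left
      ⟨a, haZ, (hmem A a haA).resolve_right fun h => hZS a h haZ⟩ (by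
        intro hsub
        exact Set.disjoint_left.1 hd (hsub hbZ).2
          ((hmem B b hbB).resolve_right fun h => hZS b h hbZ))
    refine ⟨v, hv.2, w, fun h => hwn ⟨hw, h⟩, (hG' v w hvw).resolve_left fun h => ?_⟩
    exact hwn ⟨hw, (hcl A v hv.2 w h).resolve_right fun h => hZS w h hw⟩
  have hxyD : ∃ x' y', x' ∈ reach A ∧ y' ∈ reach B ∧ G.Adj x' y' ∧
      ∀ u v, G.Adj u v → G'.Adj u v ∨ (u = x' ∧ v = y') ∨ (u = y' ∧ v = x') := by
    obtain ⟨v, hv, w, hw, hvw⟩ := hcross A B hZ.2.1 hZ.2.2 hdisj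
    obtain ⟨v', hv', w', hw', hvw'⟩ := hcross B A hZ.2.2 hZ.2.1 hdisj.symm
    have hne : v ≠ v' := fun h => Set.disjoint_left.1 hdisj hv (h ▸ hv')
    rcases hvw with ⟨rfl, rfl⟩ | ⟨rfl, rfl⟩ <;> rcases hvw' with ⟨rfl, rfl⟩ | ⟨rfl, rfl⟩
    · exact absurd rfl hne
    · exact ⟨_, _, hv, hv', hxy, hG'⟩
    · exact ⟨_, _, hv, hv', hxy.symm, fun u v h => (hG' u v h).imp_right Or.symm⟩
    · exact absurd rfl hne
  obtain ⟨x', y', hx', hy', hxy', hG''⟩ := hxyD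
  have hreachB : ∀ A B : Set V, Disjoint (reach A) (reach B) → Disjoint (reach A) B := by
    intro A B hd
    rw [Set.disjoint_left] at hd ⊢
    exact fun v hv hvB => hd hv ((hmem B v hvB).resolve_right (hnS A v hv))
  have hlt' : ∀ D, edgesMeeting G' D < G := fun D => lt_of_le_of_lt (fun u v h => h.1) hlt
  obtain ⟨Q, hQd, hQc, hQA, hQpt, hQD, hcard⟩ := linkage_to_separator (D := reach A) hlt.le hG''
    (hmem A) (hcl A) (fun h => Set.disjoint_left.1 hdisj h hy') (hreachB A B hdisj) hSk hsep
    (ih _ (hlt' _) A)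
  obtain ⟨R, hRd, hRc, hRB, hRpt, hRD, -⟩ := linkage_to_separator (D := reach B) (x := y') (y := x')
    hlt.le (fun u v h => (hG'' u v h).imp_right Or.symm)
    (hmem B) (hcl B) (fun h => Set.disjoint_left.1 hdisj hx' h) (hreachB B A hdisj.symm) hSk
    hsep.symm (ih _ (hlt' _) B)
  have hQR : ∀ i j, ∀ v, v ∈ Q i → v ∈ R j → i = j := by
    intro i j v hvi hvj
    have hvS : v ∈ S := by
      rcases hQD i hvi with h | h
      · rcases hRD j hvj with h' | h'
        · exact absurd h' (Set.disjoint_left.1 hdisj h)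
        · exact h'
      · exact h
    have h₁ : i = some ⟨v, hvS⟩ := by
      by_contra hne
      exact Set.disjoint_left.1 (hQd hne) hvi (hQpt (some ⟨v, hvS⟩))
    have h₂ : j = some ⟨v, hvS⟩ := by
      by_contra hne
      exact Set.disjoint_left.1 (hRd hne) hvj (hRpt (some ⟨v, hvS⟩))
    rw [h₁, h₂]
  let e : Fin k ≃ Option S := (Fintype.equivFinOfCardEq hcard).symm
  refine ⟨fun i => Q (e i) ∪ R (e i), fun i j hij => ?_, fun i => ?_, fun i => ?_, fun i => ?_⟩
  · have hne : e i ≠ e j := fun h => hij (e.injective h)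
    refine Set.disjoint_left.2 ?_
    rintro v (hv | hv) (hv' | hv')
    · exact Set.disjoint_left.1 (hQd hne) hv hv'
    · exact hne (hQR _ _ v hv hv')
    · exact hne (hQR _ _ v hv' hv).symm
    · exact Set.disjoint_left.1 (hRd hne) hv hv'
  · show ConnSet G (Q (e i) ∪ R (e i))
    cases h : e i with
    | none => exact (hQc none).union_adj (hRc none) (hQpt none) (hRpt none) hxy'
    | some s => exact (hQc _).union (hRc _) ⟨s, hQpt (some s), hRpt (some s)⟩
  · exact (hQA (e i)).mono (Set.inter_subset_inter_left _ Set.subset_union_left)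
  · exact (hRB (e i)).mono (Set.inter_subset_inter_left _ Set.subset_union_right)

/-- Disjoint connected sets that are pairwise joined by large linkages. -/
theorem exists_connSets_hasLinkage {V : Type*} [Finite V] {G : SimpleGraph V} {n k : ℕ}
    (hk : 1 ≤ k) {𝓑 : Set (Set V)} (hconn : ∀ X ∈ 𝓑, ConnSet G X)
    (hinter : ∀ X ∈ 𝓑, ∀ Y ∈ 𝓑, (X ∩ Y).Nonempty) (hord : OrderAtLeast 𝓑 (n * k)) :
    ∃ P : Fin n → Set V, (∀ i, ConnSet G (P i)) ∧ (Pairwise fun i j => Disjoint (P i) (P j)) ∧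
      ∀ i j, HasLinkage G (P i) (P j) k := by
  obtain ⟨P, hP, -, hPd, hPk⟩ := exists_disjoint_connSets hk n 𝓑 hconn hinter hord
  refine ⟨P, hP, hPd, fun i j => hasLinkage_of_separatorsAtLeast G _ _ _ fun S hS => ?_⟩
  by_contra! hlt
  have hmiss : ∀ i, ∃ X ∈ 𝓑, (X ∩ P i).Nonempty ∧ ∀ v ∈ S, v ∉ X := by
    intro i
    by_contra! hcon
    exact absurd (hPk i S fun X hX => hcon X hX.1 hX.2) (by omega)
  obtain ⟨X, hX, hXi, hXS⟩ := hmiss i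
  obtain ⟨Y, hY, hYj, hYS⟩ := hmiss j
  obtain ⟨v, hvS, h | h⟩ := hS (X ∪ Y) ⟨(hconn X hX).union (hconn Y hY) (hinter X hX Y hY),
    hXi.mono (Set.inter_subset_inter_left _ Set.subset_union_left),
    hYj.mono (Set.inter_subset_inter_left _ Set.subset_union_right)⟩
  exacts [hXS v hvS h, hYS v hvS h]

section DenseNeighborhood

open Classical in
/-- The neighbours of `v` in `S`. -/
noncomputable def nbrs {W : Type*} (H : SimpleGraph W) (S : Finset W) (v : W) : Finset W :=
  S.filter (H.Adj v)

theorem mem_nbrs {W : Type*} {H : SimpleGraph W} {S : Finset W} {v w : W} :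
    w ∈ nbrs H S v ↔ w ∈ S ∧ H.Adj v w := by
  simp [nbrs]

/-- Twice the number of edges of `H` inside `S`. -/
noncomputable def arcs {W : Type*} (H : SimpleGraph W) (S : Finset W) : ℕ :=
  ∑ v ∈ S, (nbrs H S v).card

variable {W : Type*} {H : SimpleGraph W}

theorem arcs_mono {H' : SimpleGraph W} (h : H ≤ H') (S : Finset W) : arcs H S ≤ arcs H' S :=
  Finset.sum_le_sum fun _ _ => Finset.card_le_card fun _ hw =>
    mem_nbrs.2 ⟨(mem_nbrs.1 hw).1, h (mem_nbrs.1 hw).2⟩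

/-- The graph in which `u` receives all the neighbours of `v`. -/
def absorb (H : SimpleGraph W) (u v : W) : SimpleGraph W :=
  H ⊔ SimpleGraph.fromRel fun a b => a = u ∧ H.Adj v b

theorem absorb_adj {u v a b : W} : (absorb H u v).Adj a b ↔
    H.Adj a b ∨ a ≠ b ∧ ((a = u ∧ H.Adj v b) ∨ (b = u ∧ H.Adj v a)) := by
  rw [absorb, sup_adj, fromRel_adj]

variable [DecidableEq W]

theorem arcs_eq_erase {S : Finset W} {v : W} (hv : v ∈ S) :
    arcs H S = arcs H (S.erase v) + 2 * (nbrs H S v).card := by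
  classical
  have h : ∀ a ∈ S.erase v, (nbrs H S a).card =
      (nbrs H (S.erase v) a).card + if H.Adj v a then 1 else 0 := by
    intro a _
    split_ifs with hva
    · rw [← Finset.card_erase_add_one (mem_nbrs.2 ⟨hv, hva.symm⟩)]
      congr 2
      ext w
      simp only [Finset.mem_erase, mem_nbrs]
      tauto
    · rw [add_zero]
      congr 1
      ext w
      simp only [Finset.mem_erase, mem_nbrs]
      constructor
      · rintro ⟨hw, haw⟩
        exact ⟨⟨fun h => hva (h ▸ haw.symm), hw⟩, haw⟩
      · rintro ⟨⟨_, hw⟩, haw⟩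
        exact ⟨hw, haw⟩
  have h' : ((S.erase v).filter (H.Adj v)) = nbrs H S v := by
    ext w
    simp only [Finset.mem_filter, Finset.mem_erase, mem_nbrs]
    constructor
    · rintro ⟨⟨_, hw⟩, haw⟩
      exact ⟨hw, haw⟩
    · rintro ⟨hw, haw⟩
      exact ⟨⟨haw.ne', hw⟩, haw⟩
  unfold arcs
  rw [← Finset.add_sum_erase S _ hv, Finset.sum_congr rfl h, Finset.sum_add_distrib,
    ← Finset.card_filter, h']
  omega

theorem arcs_le_deleteEdges {S : Finset W} {u : W} (hu : u ∈ S) (v : W) :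
    arcs H S ≤ arcs (H.deleteEdges {s(u, v)}) S + 2 := by
  have h₁ := arcs_eq_erase (H := H) hu
  have h₂ := arcs_eq_erase (H := H.deleteEdges {s(u, v)}) hu
  have h₃ : arcs H (S.erase u) ≤ arcs (H.deleteEdges {s(u, v)}) (S.erase u) := by
    refine Finset.sum_le_sum fun a ha => Finset.card_le_card fun w hw => ?_
    rw [mem_nbrs] at hw ⊢
    have ha' := Finset.ne_of_mem_erase ha
    have hw' := Finset.ne_of_mem_erase hw.1
    refine ⟨hw.1, ?_⟩
    rw [deleteEdges_adj, Set.mem_singleton_iff, Sym2.eq_iff]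
    tauto
  have h₄ : nbrs H S u ⊆ insert v (nbrs (H.deleteEdges {s(u, v)}) S u) := by
    intro w hw
    rw [mem_nbrs] at hw
    rw [Finset.mem_insert, mem_nbrs, deleteEdges_adj, Set.mem_singleton_iff, Sym2.eq_iff]
    have := hw.2.ne
    by_cases hwv : w = v
    · exact Or.inl hwv
    · refine Or.inr ⟨hw.1, hw.2, ?_⟩
      rintro (⟨-, h⟩ | ⟨-, h⟩)
      · exact hwv h
      · exact this h.symm
  have h₅ := (Finset.card_le_card h₄).trans (Finset.card_insert_le _ _)
  omega

theorem minorOf_absorb {u v : W} (huv : H.Adj u v) {S : Finset W} (hu : u ∈ S) (hv : v ∈ S) :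
    MinorOf ((absorb H u v).induce ((S.erase v : Finset W) : Set W)) (H.induce (S : Set W)) := by
  rw [minorOf_iff]
  have hsub : ∀ a : ((S.erase v : Finset W) : Set W), (a : W) ∈ (S : Set W) := fun a =>
    Finset.mem_coe.2 (Finset.mem_of_mem_erase (Finset.mem_coe.1 a.2))
  have hne : ∀ a : ((S.erase v : Finset W) : Set W), (a : W) ≠ v := fun a =>
    Finset.ne_of_mem_erase (Finset.mem_coe.1 a.2)
  refine ⟨fun a => {x | (x : W) = a ∨ ((a : W) = u ∧ (x : W) = v)}, ?_, ?_, ?_⟩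
  · intro a b hab
    refine Set.disjoint_left.2 ?_
    have hab' : (a : W) ≠ b := fun h => hab (Subtype.ext h)
    rintro x (hxa | ⟨ha, hxa⟩) (hxb | ⟨hb, hxb⟩)
    · exact hab' (hxa.symm.trans hxb)
    · exact hne a (hxa.symm.trans hxb)
    · exact hne b (hxb.symm.trans hxa)
    · exact hab' (ha.trans hb.symm)
  · intro a
    by_cases ha : (a : W) = u
    · convert ConnSet.pair (G := H.induce (S : Set W)) (u := ⟨u, hu⟩) (v := ⟨v, hv⟩)
        (by simpa using huv) using 1
      ext x
      simp [Subtype.ext_iff, ha]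
    · convert ConnSet.singleton (H.induce (S : Set W)) ⟨a, hsub a⟩ using 1
      ext x
      simp [Subtype.ext_iff, ha]
  · intro a b hab
    have hab' : (absorb H u v).Adj a b := by simpa using hab
    rw [absorb_adj] at hab'
    rcases hab' with h | ⟨-, ⟨ha, h⟩ | ⟨hb, h⟩⟩
    · exact ⟨⟨a, hsub a⟩, Or.inl rfl, ⟨b, hsub b⟩, Or.inl rfl, by simpa using h⟩
    · exact ⟨⟨v, hv⟩, Or.inr ⟨ha, rfl⟩, ⟨b, hsub b⟩, Or.inl rfl, by simpa using h⟩
    · exact ⟨⟨a, hsub a⟩, Or.inl rfl, ⟨v, hv⟩, Or.inr ⟨hb, rfl⟩, by simpa using h.symm⟩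

theorem arcs_le_absorb {u v : W} (huv : H.Adj u v) {S : Finset W} (hu : u ∈ S) (hv : v ∈ S) :
    arcs H S ≤ arcs (absorb H u v) (S.erase v) + 2 * (nbrs H S u ∩ nbrs H S v).card + 2 := by
  have hu' : u ∈ S.erase v := Finset.mem_erase.2 ⟨huv.ne, hu⟩
  have h₁ := arcs_eq_erase (H := H) hv
  have h₂ := arcs_eq_erase (H := H) hu'
  have h₃ := arcs_eq_erase (H := absorb H u v) hu'
  have h₄ := arcs_mono (H := H) (H' := absorb H u v) le_sup_left ((S.erase v).erase u)
  have h₅ : (nbrs H S v).card = ((nbrs H S v).erase u).card + 1 :=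
    (Finset.card_erase_add_one (mem_nbrs.2 ⟨hu, huv.symm⟩)).symm
  have h₆ : nbrs H (S.erase v) u ∪ (nbrs H S v).erase u ⊆ nbrs (absorb H u v) (S.erase v) u := by
    intro w hw
    simp only [Finset.mem_union, mem_nbrs, Finset.mem_erase, absorb_adj] at hw ⊢
    rcases hw with ⟨hw, h⟩ | ⟨hwu, hw, h⟩
    · exact ⟨hw, Or.inl h⟩
    · exact ⟨⟨h.ne', hw⟩, Or.inr ⟨hwu.symm, Or.inl ⟨trivial, h⟩⟩⟩
  have h₇ : nbrs H (S.erase v) u ∩ (nbrs H S v).erase u ⊆ nbrs H S u ∩ nbrs H S v := by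
    intro w hw
    simp only [Finset.mem_inter, mem_nbrs, Finset.mem_erase] at hw ⊢
    tauto
  have h₈ := Finset.card_union_add_card_inter (nbrs H (S.erase v) u) ((nbrs H S v).erase u)
  have h₉ := Finset.card_le_card h₆
  have h₁₀ := Finset.card_le_card h₇
  omega

/-- A graph of large average degree has a dense minor of bounded size. -/
theorem exists_dense_minor {D : ℕ} (hD : 1 ≤ D) (N : ℕ) : ∀ (H : SimpleGraph W) (S : Finset W),
    S.card + arcs H S ≤ N → S.Nonempty → 2 * D * S.card ≤ arcs H S →
    ∃ (H' : SimpleGraph W) (T : Finset W), MinorOf (H'.induce (T : Set W)) (H.induce (S : Set W)) ∧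
      D + 1 ≤ T.card ∧ T.card ≤ 2 * D ∧ ∀ x ∈ T, D ≤ (nbrs H' T x).card := by
  induction N with
  | zero =>
    intro H S hN hS _
    have := hS.card_pos
    omega
  | succ N ih =>
    intro H S hN hS hE
    have hone : 1 < S.card := by
      by_contra hcon
      obtain ⟨v, rfl⟩ := Finset.card_eq_one.1 (by have := hS.card_pos; omega : S.card = 1)
      have : nbrs H {v} v = ∅ := by
        ext w
        simp only [mem_nbrs, Finset.mem_singleton, Finset.notMem_empty, iff_false]
        rintro ⟨rfl, h⟩
        exact h.ne rfl
      simp [arcs, this] at hE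
      omega
    have herase : ∀ v ∈ S, (S.erase v).Nonempty ∧ (S.erase v).card + 1 = S.card := by
      intro v hv
      have := Finset.card_erase_add_one hv
      exact ⟨Finset.card_pos.1 (by omega), this⟩
    by_cases hdeg : ∃ v ∈ S, (nbrs H S v).card ≤ D
    · obtain ⟨v, hv, hvD⟩ := hdeg
      obtain ⟨hne, hcard⟩ := herase v hv
      have h₁ := arcs_eq_erase (H := H) hv
      obtain ⟨H', T, hm, hT⟩ := ih H (S.erase v) (by omega) hne (by
        rw [← hcard] at hE
        rw [mul_add] at hE
        omega)
      refine ⟨H', T, hm.trans ?_, hT⟩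
      exact .of_injective (Set.inclusion (by simp)) (Set.inclusion_injective _)
        fun a b h => by simpa using h
    by_cases hcodeg : ∃ u ∈ S, ∃ v ∈ S, H.Adj u v ∧ (nbrs H S u ∩ nbrs H S v).card < D
    · obtain ⟨u, hu, v, hv, huv, hlt⟩ := hcodeg
      obtain ⟨hne, hcard⟩ := herase v hv
      have h₁ := arcs_le_absorb huv hu hv
      have h₂ : arcs (absorb H u v) (S.erase v) ≤ arcs H S := by
        have hu' : u ∈ S.erase v := Finset.mem_erase.2 ⟨huv.ne, hu⟩
        have e₁ := arcs_eq_erase (H := H) hv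
        have e₂ := arcs_eq_erase (H := H) hu'
        have e₃ := arcs_eq_erase (H := absorb H u v) hu'
        have e₄ : arcs (absorb H u v) ((S.erase v).erase u) ≤ arcs H ((S.erase v).erase u) := by
          refine Finset.sum_le_sum fun a ha => Finset.card_le_card fun w hw => ?_
          simp only [mem_nbrs, absorb_adj, Finset.mem_erase] at ha hw ⊢
          tauto
        have e₅ : nbrs (absorb H u v) (S.erase v) u ⊆
            nbrs H (S.erase v) u ∪ nbrs H S v := by
          intro w hw
          simp only [Finset.mem_union, mem_nbrs, Finset.mem_erase, absorb_adj] at hw ⊢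
          obtain ⟨⟨h₀, h₀'⟩, h | ⟨h', h | ⟨h, -⟩⟩⟩ := hw
          · exact Or.inl ⟨⟨h₀, h₀'⟩, h⟩
          · exact Or.inr ⟨h₀', h.2⟩
          · exact absurd h.symm h'
        have e₆ := (Finset.card_le_card e₅).trans (Finset.card_union_le _ _)
        omega
      obtain ⟨H', T, hm, hT⟩ := ih (absorb H u v) (S.erase v) (by omega) hne (by
        rw [← hcard] at hE
        rw [mul_add] at hE
        omega)
      exact ⟨H', T, hm.trans (minorOf_absorb huv hu hv), hT⟩
    push Not at hdeg hcodeg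
    by_cases hmany : 2 * D * S.card + 2 ≤ arcs H S
    · obtain ⟨u, hu⟩ := hS
      obtain ⟨v, hv⟩ := Finset.card_pos.1 (lt_of_le_of_lt (Nat.zero_le _) (hdeg u hu))
      rw [mem_nbrs] at hv
      have h₁ := arcs_le_deleteEdges (H := H) hu v
      have h₂ : arcs (H.deleteEdges {s(u, v)}) S < arcs H S := by
        refine Finset.sum_lt_sum (fun a _ => Finset.card_le_card fun w hw => ?_)
          ⟨u, hu, Finset.card_lt_card ⟨fun w hw => ?_, fun hsub => ?_⟩⟩
        · exact mem_nbrs.2 ⟨(mem_nbrs.1 hw).1, deleteEdges_le _ (mem_nbrs.1 hw).2⟩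
        · exact mem_nbrs.2 ⟨(mem_nbrs.1 hw).1, deleteEdges_le _ (mem_nbrs.1 hw).2⟩
        · simpa using (mem_nbrs.1 (hsub (mem_nbrs.2 hv))).2
      obtain ⟨H', T, hm, hT⟩ := ih (H.deleteEdges {s(u, v)}) S (by omega) ⟨u, hu⟩ (by omega)
      refine ⟨H', T, hm.trans ?_, hT⟩
      refine .of_injective id Function.injective_id fun a b h => ?_
      have h' : (H.deleteEdges {s(u, v)}).Adj a b := by simpa using h
      simpa using deleteEdges_le _ h'
    obtain ⟨v, hv, hvD⟩ : ∃ v ∈ S, (nbrs H S v).card ≤ 2 * D := by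
      by_contra! hcon
      have : S.card * (2 * D + 1) ≤ arcs H S :=
        Finset.card_nsmul_le_sum S (fun v => (nbrs H S v).card) _ hcon
      rw [mul_add, mul_comm] at this
      omega
    refine ⟨H, nbrs H S v, ?_, hdeg v hv, hvD, fun x hx => ?_⟩
    · exact .of_injective (Set.inclusion fun w hw => (mem_nbrs.1 hw).1)
        (Set.inclusion_injective _) fun a b h => by simpa using h
    · rw [mem_nbrs] at hx
      refine (hcodeg v hv x hx.1 hx.2).trans (Finset.card_le_card fun w hw => ?_)
      simp only [Finset.mem_inter, mem_nbrs] at hw ⊢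
      tauto

end DenseNeighborhood

theorem sum_pow_lt_of_small {ι : Type*} {J : Finset ι} {A : ι → ℕ} {x y p l : ℕ} (hJ : J.card ≤ l)
    (hp : 2 * 9 ^ p ≤ 10 ^ p) (hl : l * (9 ^ p) ^ (2 * p) < (10 ^ p) ^ (2 * p)) (hx : x ≤ 2 * y)
    (hy : 0 < y) (hA : ∀ j ∈ J, A j * 10 ^ (2 * p) ≤ 9 ^ (2 * p) * x) :
    ∑ j ∈ J, A j ^ (2 * p) < y ^ (2 * p) := by
  have h₁ : ∀ j ∈ J, A j * 10 ^ p ≤ 9 ^ p * y := by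
    intro j hj
    have h₂ := hA j hj
    rw [two_mul, pow_add, pow_add] at h₂
    have h₃ : 9 ^ p * (9 ^ p * x) ≤ 9 ^ p * (10 ^ p * y) := by
      refine Nat.mul_le_mul_left _ ?_
      calc 9 ^ p * x ≤ 9 ^ p * (2 * y) := Nat.mul_le_mul_left _ hx
        _ = 2 * 9 ^ p * y := by ring
        _ ≤ _ := Nat.mul_le_mul_right _ hp
    have h₄ : 10 ^ p * (A j * 10 ^ p) ≤ 10 ^ p * (9 ^ p * y) := by nlinarith
    exact Nat.le_of_mul_le_mul_left h₄ (by positivity)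
  refine Nat.lt_of_mul_lt_mul_right (a := (10 ^ p) ^ (2 * p)) ?_
  calc (∑ j ∈ J, A j ^ (2 * p)) * (10 ^ p) ^ (2 * p)
      = ∑ j ∈ J, (A j * 10 ^ p) ^ (2 * p) := by
        rw [Finset.sum_mul]
        exact Finset.sum_congr rfl fun j _ => (mul_pow _ _ _).symm
    _ ≤ ∑ _j ∈ J, (9 ^ p * y) ^ (2 * p) :=
        Finset.sum_le_sum fun j hj => Nat.pow_le_pow_left (h₁ j hj) _
    _ = J.card * (9 ^ p) ^ (2 * p) * y ^ (2 * p) := by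
        rw [Finset.sum_const, smul_eq_mul, mul_pow, mul_assoc]
    _ ≤ l * (9 ^ p) ^ (2 * p) * y ^ (2 * p) := by gcongr
    _ < (10 ^ p) ^ (2 * p) * y ^ (2 * p) := by gcongr
    _ = _ := mul_comm _ _

section DenseMinor

variable {V : Type*} {K : SimpleGraph V}

/-- `u` and `w` lie in a connected set of at most five vertices avoiding `F`. -/
def LinkedAvoiding (K : SimpleGraph V) (F : Finset V) (u w : V) : Prop :=
  ∃ C : Finset V, ConnSet K (C : Set V) ∧ u ∈ C ∧ w ∈ C ∧ C.card ≤ 5 ∧ Disjoint C F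

variable [DecidableEq V]

theorem LinkedAvoiding.of_adj {F : Finset V} {u w : V} (h : K.Adj u w) (hu : u ∉ F) (hw : w ∉ F) :
    LinkedAvoiding K F u w := by
  refine ⟨{u, w}, ?_, by simp, by simp, Finset.card_le_two.trans (by norm_num), ?_⟩
  · simpa using ConnSet.pair h
  · simp [Finset.disjoint_left, hu, hw]

theorem LinkedAvoiding.of_adj_two {F : Finset V} {u v w : V} (h₁ : K.Adj u v) (h₂ : K.Adj v w)
    (hu : u ∉ F) (hv : v ∉ F) (hw : w ∉ F) :
    LinkedAvoiding K F u w := by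
  refine ⟨{w, u, v}, ?_, by simp, by simp, Finset.card_le_three.trans (by norm_num), ?_⟩
  · simpa using (ConnSet.pair h₁).insert_adj (by simp) h₂
  · simp [Finset.disjoint_left, hu, hv, hw]

theorem LinkedAvoiding.of_adj_four {F : Finset V} {u p z q w : V} (h₁ : K.Adj u p) (h₂ : K.Adj p z)
    (h₃ : K.Adj z q) (h₄ : K.Adj q w) (hu : u ∉ F) (hp : p ∉ F) (hz : z ∉ F) (hq : q ∉ F)
    (hw : w ∉ F) :
    LinkedAvoiding K F u w := by
  refine ⟨{w, q, z, u, p}, ?_, by simp, by simp, Finset.card_le_five, ?_⟩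
  · have := (((ConnSet.pair h₁).insert_adj (by simp) h₂).insert_adj (by simp) h₃).insert_adj
      (by simp) h₄
    simpa using this
  · simp [Finset.disjoint_left, hu, hp, hz, hq, hw]

/-- Some `s`-tuple of `Y` leaves few vertices of `Z` undominated. -/
theorem exists_dominating_tuple {Y : Finset V} (hY : Y.Nonempty) (s : ℕ) (Z : Finset V)
    (h : ∀ z ∈ Z, Y.card ≤ 10 * (nbrs K Y z).card) :
    ∃ (b : Fin s → V) (A : Finset V), (∀ i, b i ∈ Y) ∧ A ⊆ Z ∧
      (∀ z ∈ Z, z ∉ A → ∃ i, K.Adj z (b i)) ∧ A.card * 10 ^ s ≤ 9 ^ s * Z.card := by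
  induction s with
  | zero =>
    exact ⟨fun i => i.elim0, Z, fun i => i.elim0, subset_rfl, fun z hz hz' => absurd hz hz', by simp⟩
  | succ s ih =>
    obtain ⟨b, A, hb, hAZ, hA, hcard⟩ := ih
    classical
    have hsplit : ∀ z, (nbrs K Y z).card + (Y.filter fun y => ¬ K.Adj z y).card = Y.card := by
      intro z
      rw [show nbrs K Y z = Y.filter (K.Adj z) by ext; simp [mem_nbrs]]
      exact Finset.card_filter_add_card_filter_not _
    have hsum : ∑ y ∈ Y, 10 * (A.filter fun z => ¬ K.Adj z y).card ≤ ∑ _y ∈ Y, 9 * A.card := by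
      have h₁ := Finset.sum_card_bipartiteAbove_eq_sum_card_bipartiteBelow (s := A) (t := Y)
        fun z y => ¬ K.Adj z y
      simp only [Finset.bipartiteAbove, Finset.bipartiteBelow] at h₁
      rw [← Finset.mul_sum, ← h₁, Finset.mul_sum, Finset.sum_const, smul_eq_mul,
        show Y.card * (9 * A.card) = A.card • (9 * Y.card) by rw [smul_eq_mul]; ring]
      refine Finset.sum_le_card_nsmul _ _ _ fun z hz => ?_
      have := h z (hAZ hz)
      have := hsplit z
      omega
    obtain ⟨y, hy, hle⟩ := Finset.exists_le_of_sum_le hY hsum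
    refine ⟨Fin.cons y b, A.filter fun z => ¬ K.Adj z y, ?_, (Finset.filter_subset _ _).trans hAZ,
      ?_, ?_⟩
    · exact Fin.cases hy hb
    · intro z hz hzA
      by_cases hzA' : z ∈ A
      · exact ⟨0, by simpa [hzA'] using hzA⟩
      · obtain ⟨i, hi⟩ := hA z hz hzA'
        exact ⟨i.succ, by simpa using hi⟩
    · rw [pow_succ, pow_succ]
      nlinarith [Nat.mul_le_mul_right (10 ^ s) hle]

variable [Fintype V]

theorem exists_common_nbr {F : Finset V} {u v : V} (hF : 100 * F.card ≤ Fintype.card V)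
    (h : Fintype.card V ≤ 6 * (nbrs K Finset.univ u ∩ nbrs K Finset.univ v).card)
    (hpos : 0 < Fintype.card V) : ∃ p ∉ F, K.Adj u p ∧ K.Adj p v := by
  by_contra! hcon
  have : nbrs K Finset.univ u ∩ nbrs K Finset.univ v ⊆ F := by
    intro p hp
    simp only [Finset.mem_inter, mem_nbrs, Finset.mem_univ, true_and] at hp
    by_contra hpF
    exact hcon p hpF hp.1 hp.2.symm
  have := Finset.card_le_card this
  omega

/-- In a dense graph there is a large set `Z` any two of whose vertices can be linked robustly. -/
theorem exists_linked_set (hpos : 0 < Fintype.card V)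
    (hdeg : ∀ v, Fintype.card V ≤ 2 * (nbrs K Finset.univ v).card) :
    ∃ Z : Finset V, Fintype.card V ≤ 4 * Z.card ∧ ∀ F : Finset V, 100 * F.card ≤ Fintype.card V →
      ∃ u ∈ Z \ F, ∃ Y : Finset V, Y.Nonempty ∧ Disjoint Y F ∧
        (∀ z ∈ Z, Y.card ≤ 10 * (nbrs K Y z).card) ∧
        ∀ w ∈ Y ∪ Z \ F, LinkedAvoiding K F u w := by
  set n := Fintype.card V with hn
  let N : V → Finset V := nbrs K Finset.univ
  have hN : ∀ v w, w ∈ N v ↔ K.Adj v w := fun v w => by simp [N, mem_nbrs]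
  let L : V → Finset V := fun x => Finset.univ.filter fun z => 6 * (N x ∩ N z).card < n
  have huniv : ∀ S : Finset V, S.card ≤ n := fun S => Finset.card_le_univ S
  by_cases hB : ∃ x, n ≤ 4 * (L x).card
  · obtain ⟨x, hx⟩ := hB
    have hcod : ∀ z ∈ L x, ∀ z' ∈ L x, n ≤ 6 * (N z ∩ N z').card := by
      intro z hz z' hz'
      simp only [L, Finset.mem_filter, Finset.mem_univ, true_and] at hz hz'
      have h₁ := Finset.card_union_add_card_inter (N x) (N z)
      have h₂ := Finset.card_union_add_card_inter (N x ∪ N z) (N z')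
      have h₃ := Finset.card_union_le (N x ∩ N z') (N z ∩ N z')
      rw [← Finset.union_inter_distrib_right] at h₃
      have h₄ := huniv (N x ∪ N z ∪ N z')
      have := hdeg x
      have := hdeg z
      have := hdeg z'
      change n ≤ 2 * (N _).card at *
      omega
    refine ⟨L x, hx, fun F hF => ?_⟩
    have : (L x \ F).Nonempty := by
      rw [← Finset.card_pos]
      have := Finset.le_card_sdiff F (L x)
      omega
    obtain ⟨u, hu⟩ := this
    have hu' := Finset.mem_sdiff.1 hu
    refine ⟨u, hu, N u \ F, ?_, Finset.sdiff_disjoint, fun z hz => ?_, fun w hw => ?_⟩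
    · rw [← Finset.card_pos]
      have := Finset.le_card_sdiff F (N u)
      have : n ≤ 2 * (N u).card := hdeg u
      omega
    · have h₁ : nbrs K (N u \ F) z = (N z ∩ N u) \ F := by
        ext w
        simp only [mem_nbrs, Finset.mem_sdiff, Finset.mem_inter, hN]
        tauto
      rw [h₁]
      have := Finset.le_card_sdiff F (N z ∩ N u)
      have := hcod z hz u hu'.1
      have := huniv (N u \ F)
      omega
    · rw [Finset.mem_union, Finset.mem_sdiff, Finset.mem_sdiff] at hw
      rcases hw with ⟨hw, hwF⟩ | ⟨hw, hwF⟩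
      · exact .of_adj ((hN _ _).1 hw) hu'.2 hwF
      · obtain ⟨p, hp, h₁, h₂⟩ := exists_common_nbr hF (hcod u hu'.1 w hw) hpos
        exact .of_adj_two h₁ h₂ hu'.2 hp hwF
  · push Not at hB
    refine ⟨Finset.univ, by simp [← hn]; omega, fun F hF => ?_⟩
    have : (Finset.univ \ F).Nonempty := by
      rw [← Finset.card_pos]
      have := Finset.le_card_sdiff F Finset.univ
      rw [Finset.card_univ] at this
      omega
    obtain ⟨u, hu⟩ := this
    have hu' := Finset.mem_sdiff.1 hu
    refine ⟨u, hu, Finset.univ \ F, ⟨u, hu⟩, Finset.sdiff_disjoint, fun z hz => ?_, fun w hw => ?_⟩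
    · have h₁ : nbrs K (Finset.univ \ F) z = N z \ F := by
        ext w
        simp only [mem_nbrs, Finset.mem_sdiff, Finset.mem_univ, hN]
        tauto
      rw [h₁]
      have := Finset.le_card_sdiff F (N z)
      have : n ≤ 2 * (N z).card := hdeg z
      have := huniv (Finset.univ \ F)
      omega
    · rw [Finset.union_self, Finset.mem_sdiff] at hw
      obtain ⟨z, hz⟩ : ∃ z, z ∉ F ∪ (L u ∪ L w) := by
        by_contra! hcon
        have h₁ : (F ∪ (L u ∪ L w)).card = n := by
          rw [Finset.eq_univ_iff_forall.2 hcon, Finset.card_univ]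
        have := Finset.card_union_le F (L u ∪ L w)
        have := Finset.card_union_le (L u) (L w)
        have := hB u
        have := hB w
        omega
      simp only [L, Finset.mem_union, Finset.mem_filter, Finset.mem_univ, true_and, not_or,
        not_lt] at hz
      obtain ⟨p, hp, h₁, h₂⟩ := exists_common_nbr hF hz.2.1 hpos
      obtain ⟨q, hq, h₃, h₄⟩ := exists_common_nbr hF hz.2.2 hpos
      exact .of_adj_four h₁ h₂ h₄.symm h₃.symm hu'.2 hp hz.1 hq hw.2

/-- If few tuples lie in the sets `A j`, some tuple leaves each of them. -/
theorem exists_tuple_notMem {ι : Type*} {J : Finset ι} {A : ι → Finset V} {Z : Finset V} {s : ℕ}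
    (h : ∑ j ∈ J, (A j).card ^ s < Z.card ^ s) :
    ∃ a : Fin s → V, (∀ i, a i ∈ Z) ∧ ∀ j ∈ J, ∃ i, a i ∉ A j := by
  by_contra! hcon
  have hsub : Fintype.piFinset (fun _ : Fin s => Z) ⊆
      J.biUnion fun j => Fintype.piFinset fun _ : Fin s => A j := by
    intro a ha
    obtain ⟨j, hj, h⟩ := hcon a (Fintype.mem_piFinset.1 ha)
    exact Finset.mem_biUnion.2 ⟨j, hj, Fintype.mem_piFinset.2 h⟩
  have := (Finset.card_le_card hsub).trans Finset.card_biUnion_le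
  simp only [Fintype.card_piFinset_const] at this
  omega

/-- Branch sets of a complete minor can be found greedily, each dominating most of `Z`. -/
theorem exists_branchSets {l p : ℕ} (hp₀ : 0 < p) (hp : 2 * 9 ^ p ≤ 10 ^ p)
    (hl : l * (9 ^ p) ^ (2 * p) < (10 ^ p) ^ (2 * p)) (hpos : 0 < Fintype.card V)
    (hcard : 2000 * l * p ≤ Fintype.card V) {Z : Finset V} (hZ : Fintype.card V ≤ 4 * Z.card)
    (hlink : ∀ F : Finset V, 100 * F.card ≤ Fintype.card V →
      ∃ u ∈ Z \ F, ∃ Y : Finset V, Y.Nonempty ∧ Disjoint Y F ∧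
        (∀ z ∈ Z, Y.card ≤ 10 * (nbrs K Y z).card) ∧
        ∀ w ∈ Y ∪ Z \ F, LinkedAvoiding K F u w) (m : ℕ) (hm : m ≤ l) :
    ∃ B A : ℕ → Finset V, (∀ i < m, ConnSet K (B i : Set V) ∧ (B i).card ≤ 20 * p ∧
        (A i).card * 10 ^ (2 * p) ≤ 9 ^ (2 * p) * Z.card ∧
        ∀ z ∈ Z, z ∉ A i → ∃ v ∈ B i, K.Adj z v) ∧
      ∀ j < m, ∀ i < j, Disjoint (B i) (B j) ∧ ∃ u ∈ B i, ∃ v ∈ B j, K.Adj u v := by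
  induction m with
  | zero => exact ⟨fun _ => ∅, fun _ => ∅, by simp, by simp⟩
  | succ m ih =>
    obtain ⟨B, A, hBA, hB⟩ := ih (by omega)
    set F := (Finset.range m).biUnion B with hF
    have hFcard : 100 * F.card ≤ Fintype.card V := by
      have h₁ : F.card ≤ (Finset.range m).card * (20 * p) :=
        Finset.card_biUnion_le_card_mul _ _ _ fun i hi => (hBA i (Finset.mem_range.1 hi)).2.1
      rw [Finset.card_range] at h₁
      have h₂ : m * (20 * p) ≤ l * (20 * p) := Nat.mul_le_mul_right _ (by omega)
      have h₃ : 2000 * l * p = 100 * (l * (20 * p)) := by ring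
      omega
    obtain ⟨u, hu, Y, hY, hYF, hYZ, hlinked⟩ := hlink F hFcard
    have hsd := Finset.le_card_sdiff F Z
    obtain ⟨a, ha, haA⟩ := exists_tuple_notMem (J := Finset.range m) (A := A) (Z := Z \ F)
      (sum_pow_lt_of_small (x := Z.card) (by rw [Finset.card_range]; omega) hp hl (by omega)
        (by omega) fun j hj => (hBA j (Finset.mem_range.1 hj)).2.2.1)
    obtain ⟨b, A', hb, -, hA', hA'card⟩ := exists_dominating_tuple hY (2 * p) Z hYZ
    have hC : ∀ i : Fin (2 * p) ⊕ Fin (2 * p), LinkedAvoiding K F u (Sum.elim a b i) := by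
      rintro (i | i)
      · exact hlinked _ (Finset.mem_union_right _ (ha i))
      · exact hlinked _ (Finset.mem_union_left _ (hb i))
    choose C hCc hCu hCw hC5 hCF using hC
    have : Nonempty (Fin (2 * p) ⊕ Fin (2 * p)) := ⟨Sum.inl ⟨0, by omega⟩⟩
    set B' := Finset.univ.biUnion C with hB'
    have hmem : ∀ i, Sum.elim a b i ∈ B' := fun i =>
      Finset.mem_biUnion.2 ⟨i, Finset.mem_univ _, hCw i⟩
    refine ⟨Function.update B m B', Function.update A m A', fun i hi => ?_, fun j hj i hij => ?_⟩
    · rcases Nat.lt_succ_iff_lt_or_eq.1 hi with h | rfl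
      · rw [Function.update_of_ne h.ne, Function.update_of_ne h.ne]
        exact hBA i h
      · rw [Function.update_self, Function.update_self]
        refine ⟨?_, ?_, hA'card, fun z hz hzA => ?_⟩
        · rw [hB', Finset.coe_biUnion]
          simpa using ConnSet.iUnion_mem (u := u) hCc hCu
        · refine (Finset.card_biUnion_le_card_mul _ _ 5 fun i _ => hC5 i).trans ?_
          simp only [Finset.card_univ, Fintype.card_sum, Fintype.card_fin]
          omega
        · obtain ⟨i, hi⟩ := hA' z hz hzA
          exact ⟨b i, hmem (Sum.inr i), hi⟩
    · rw [Function.update_of_ne (by omega : i ≠ m)]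
      rcases Nat.lt_succ_iff_lt_or_eq.1 hj with h | rfl
      · rw [Function.update_of_ne h.ne]
        exact hB j h i hij
      · rw [Function.update_self]
        refine ⟨?_, ?_⟩
        · refine (Finset.disjoint_biUnion_right _ _ _).2 fun c _ => ?_
          exact ((hCF c).mono_right (Finset.subset_biUnion_of_mem B (Finset.mem_range.2 hij))).symm
        · obtain ⟨c, hc⟩ := haA i (Finset.mem_range.2 hij)
          obtain ⟨v, hv, hadj⟩ := (hBA i hij).2.2.2 (a c) (Finset.mem_sdiff.1 (ha c)).1 hc
          exact ⟨v, hv, a c, hmem (Sum.inl c), hadj.symm⟩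

/-- A dense graph on few vertices has a complete minor. -/
theorem completeMinor_of_half_dense {l p : ℕ} (hp₀ : 0 < p) (hp : 2 * 9 ^ p ≤ 10 ^ p)
    (hl : l * (9 ^ p) ^ (2 * p) < (10 ^ p) ^ (2 * p)) (hpos : 0 < Fintype.card V)
    (hcard : 2000 * l * p ≤ Fintype.card V)
    (hdeg : ∀ v, Fintype.card V ≤ 2 * (nbrs K Finset.univ v).card) :
    MinorOf (completeGraph (Fin l)) K := by
  obtain ⟨Z, hZ, hlink⟩ := exists_linked_set hpos hdeg
  obtain ⟨B, A, hBA, hB⟩ := exists_branchSets hp₀ hp hl hpos hcard hZ hlink l le_rfl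
  refine minorOf_iff.2 ⟨fun i => (B i : Set V), fun i j hij => ?_, fun i => (hBA i i.2).1,
    fun i j hij => ?_⟩
  · rcases lt_or_gt_of_ne hij with h | h
    · exact Finset.disjoint_coe.2 (hB j j.2 i h).1
    · exact Finset.disjoint_coe.2 (hB i i.2 j h).1.symm
  · rcases lt_or_gt_of_ne hij.ne with h | h
    · exact (hB j j.2 i h).2
    · obtain ⟨u, hu, v, hv, huv⟩ := (hB i i.2 j h).2
      exact ⟨v, hv, u, hu, huv.symm⟩

/-- A graph of large average degree has a complete minor. -/
theorem completeMinor_of_arcs {W : Type*} [Fintype W] [Nonempty W] {H : SimpleGraph W} {l p : ℕ}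
    (hl₀ : 0 < l) (hp₀ : 0 < p) (hp : 2 * 9 ^ p ≤ 10 ^ p)
    (hl : l * (9 ^ p) ^ (2 * p) < (10 ^ p) ^ (2 * p))
    (h : 2 * (2000 * l * p) * Fintype.card W ≤ arcs H Finset.univ) :
    MinorOf (completeGraph (Fin l)) H := by
  classical
  obtain ⟨H', T, hm, hT₁, hT₂, hdeg⟩ := exists_dense_minor (D := 2000 * l * p)
    (Nat.one_le_iff_ne_zero.2 (by positivity)) _ H Finset.univ le_rfl Finset.univ_nonempty
    (by rwa [Finset.card_univ])
  have hcard : Fintype.card ((T : Set W)) = T.card := by simp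
  refine (completeMinor_of_half_dense hp₀ hp hl (by omega) (by omega) fun v => ?_).trans
    (hm.trans (.of_injective Subtype.val Subtype.val_injective fun a b hab => by simpa using hab))
  have h₁ : (nbrs (H'.induce (T : Set W)) Finset.univ v).card = (nbrs H' T v).card := by
    rw [← Finset.card_map (Function.Embedding.subtype _)]
    congr 1
    ext w
    simp [mem_nbrs, and_comm]
  have := hdeg v (Finset.mem_coe.1 v.2)
  omega

end DenseMinor

section Transversal

variable {E : Type*} {k : ℕ}

/-- The restriction of `τ` to `S` has no conflict. -/
def ConflictFree (C : E → E → Fin k → Fin k → Prop) (S : Finset E) (τ : E → Fin k) : Prop :=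
  ∀ e ∈ S, ∀ f ∈ S, e ≠ f → ¬ C e f (τ e) (τ f)

variable [Fintype E] [DecidableEq E]

open Classical in
/-- The number of transversals without a conflict on `S`. -/
noncomputable def numConflictFree (C : E → E → Fin k → Fin k → Prop) (S : Finset E) : ℕ :=
  (Finset.univ.filter fun τ : E → Fin k => ConflictFree C S τ).card

open Classical in
theorem card_conflict_le {C : E → E → Fin k → Fin k → Prop} {M : ℕ} {e f : E} (hef : e ≠ f)
    (hM : (Finset.univ.filter fun x : Fin k × Fin k => C e f x.1 x.2).card ≤ M) {S : Finset E}
    (he : e ∉ S) (hf : f ∉ S) :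
    k ^ 2 * (Finset.univ.filter fun τ : E → Fin k => ConflictFree C S τ ∧ C e f (τ e) (τ f)).card ≤
      M * numConflictFree C S := by
  refine le_trans ?_ (Nat.mul_le_mul_right _ hM)
  have hk : k ^ 2 = (Finset.univ : Finset (Fin k × Fin k)).card := by simp [sq]
  rw [numConflictFree, ← Finset.card_product, hk, ← Finset.card_product]
  refine Finset.card_le_card_of_injOn
    (fun x => ((x.2 e, x.2 f), Function.update (Function.update x.2 e x.1.1) f x.1.2)) ?_ ?_
  · rintro ⟨⟨c, d⟩, τ⟩ hx
    simp only [Finset.coe_product, Finset.coe_univ, Finset.coe_filter, Set.mem_prod, Set.mem_univ,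
      Finset.mem_univ, true_and, Set.mem_ofPred_eq] at hx ⊢
    refine ⟨hx.2, fun a ha b hb hab => ?_⟩
    have hne : ∀ g ∈ S, Function.update (Function.update τ e c) f d g = τ g := by
      intro g hg
      rw [Function.update_of_ne (ne_of_mem_of_not_mem hg hf),
        Function.update_of_ne (ne_of_mem_of_not_mem hg he)]
    rw [hne a ha, hne b hb]
    exact hx.1 a ha b hb hab
  · rintro ⟨⟨c, d⟩, τ⟩ - ⟨⟨c', d'⟩, τ'⟩ - h
    simp only [Prod.mk.injEq] at h
    obtain ⟨⟨h₁, h₂⟩, h₃⟩ := h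
    have hc := congrFun h₃ e
    have hd := congrFun h₃ f
    simp only [Function.update_self, Function.update_of_ne hef] at hc hd
    refine Prod.ext (Prod.ext hc hd) (funext fun g => ?_)
    by_cases hge : g = e
    · exact hge ▸ h₁
    by_cases hgf : g = f
    · exact hgf ▸ h₂
    have := congrFun h₃ g
    simpa [Function.update_of_ne hge, Function.update_of_ne hgf] using this

open Classical in
/-- Sparse conflicts between large classes can be avoided. -/
theorem exists_conflictFree {C : E → E → Fin k → Fin k → Prop} {M : ℕ} (hk : 0 < k)
    (hsymm : ∀ e f a b, C e f a b → C f e b a)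
    (hM : ∀ e f, e ≠ f → (Finset.univ.filter fun x : Fin k × Fin k => C e f x.1 x.2).card ≤ M)
    (hEM : 4 * (Fintype.card E * M) ≤ k ^ 2) :
    ∃ τ : E → Fin k, ∀ e f, e ≠ f → ¬ C e f (τ e) (τ f) := by
  have key : ∀ n, ∀ S : Finset E, S.card = n → ∀ e ∉ S,
      numConflictFree C S ≤ 2 * numConflictFree C (insert e S) := by
    intro n
    induction n with
    | zero =>
      intro S hS e _
      rw [Finset.card_eq_zero.1 hS]
      refine (Finset.card_le_card fun τ _ => ?_).trans (Nat.le_mul_of_pos_left _ two_pos)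
      simp only [Finset.mem_filter, Finset.mem_univ, true_and, ConflictFree,
        insert_empty_eq, Finset.mem_singleton]
      rintro a rfl b rfl h
      exact absurd rfl h
    | succ n ih =>
      intro S hS e he
      have hsub : (Finset.univ.filter fun τ : E → Fin k => ConflictFree C S τ) ⊆
          (Finset.univ.filter fun τ : E → Fin k => ConflictFree C (insert e S) τ) ∪
          S.biUnion fun f => Finset.univ.filter fun τ : E → Fin k =>
            ConflictFree C (S.erase f) τ ∧ C e f (τ e) (τ f) := by
        intro τ hτ
        simp only [Finset.mem_filter, Finset.mem_univ, true_and, Finset.mem_union,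
          Finset.mem_biUnion] at hτ ⊢
        by_cases h : ∃ f ∈ S, C e f (τ e) (τ f)
        · obtain ⟨f, hf, h⟩ := h
          exact Or.inr ⟨f, hf, fun a ha b hb => hτ a (Finset.mem_of_mem_erase ha) b
            (Finset.mem_of_mem_erase hb), h⟩
        · push Not at h
          refine Or.inl fun a ha b hb hab hC => ?_
          rcases Finset.mem_insert.1 ha with hae | ha <;> rcases Finset.mem_insert.1 hb with hbe | hb
          · exact hab (hae.trans hbe.symm)
          · exact h b hb (hae ▸ hC)
          · exact h a ha (hbe ▸ hsymm _ _ _ _ hC)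
          · exact hτ a ha b hb hab hC
      have h₁ : numConflictFree C S ≤ _ := (Finset.card_le_card hsub).trans
        ((Finset.card_union_le _ _).trans (Nat.add_le_add_left Finset.card_biUnion_le _))
      set B : E → ℕ := fun f => (Finset.univ.filter fun τ : E → Fin k =>
            ConflictFree C (S.erase f) τ ∧ C e f (τ e) (τ f)).card
      change _ ≤ numConflictFree C (insert e S) + ∑ f ∈ S, B f at h₁
      have h₂ : ∀ f ∈ S, k ^ 2 * B f ≤ M * (2 * numConflictFree C S) := by
        intro f hf
        have hef : e ≠ f := fun h => he (h ▸ hf)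
        refine (card_conflict_le hef (hM e f hef) (fun h => he (Finset.mem_of_mem_erase h))
          (Finset.notMem_erase f S)).trans (Nat.mul_le_mul_left _ ?_)
        have := ih (S.erase f) (by rw [Finset.card_erase_of_mem hf]; omega) f
          (Finset.notMem_erase f S)
        rwa [Finset.insert_erase hf] at this
      have h₃ : k ^ 2 * ∑ f ∈ S, B f ≤ S.card * (M * (2 * numConflictFree C S)) := by
        rw [Finset.mul_sum]
        exact Finset.sum_le_card_nsmul _ _ _ h₂
      have h₄ : S.card * (M * (2 * numConflictFree C S)) ≤
          Fintype.card E * (M * (2 * numConflictFree C S)) :=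
        Nat.mul_le_mul_right _ (Finset.card_le_univ S)
      have h₅ := Nat.mul_le_mul_right (numConflictFree C S) hEM
      have h₆ : k ^ 2 * (2 * ∑ f ∈ S, B f) ≤ k ^ 2 * numConflictFree C S := by nlinarith
      have h₇ := Nat.le_of_mul_le_mul_left h₆ (by positivity)
      omega
  have hpos : ∀ S : Finset E, 0 < numConflictFree C S := by
    intro S
    induction S using Finset.induction_on with
    | empty => exact Finset.card_pos.2 ⟨fun _ => ⟨0, hk⟩, by simp [ConflictFree]⟩
    | insert e S he ih =>
      have := key _ S rfl e he
      omega
  obtain ⟨τ, hτ⟩ := Finset.card_pos.1 (hpos Finset.univ)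
  refine ⟨τ, fun e f hef => ?_⟩
  exact (Finset.mem_filter.1 hτ).2 e (Finset.mem_univ _) f (Finset.mem_univ _) hef

end Transversal

theorem ConnSet.star {V : Type*} {G : SimpleGraph V} {X : Set V} {c : V} (hc : c ∈ X)
    (h : ∀ x ∈ X, x = c ∨ G.Adj c x) : ConnSet G X := by
  refine ⟨⟨c, hc⟩, ?_⟩
  rintro Y hY ⟨y, hy⟩ hcl
  have hcY : c ∈ Y := by
    rcases h y (hY hy) with rfl | hyc
    · exact hy
    · exact hcl y hy c hc hyc.symm
  intro x hx
  rcases h x hx with rfl | hxc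
  · exact hcY
  · exact hcl c hcY x hx hxc

/-- The bipartite graph recording which members of `X` meet which members of `Y`. -/
def crossingGraph {V α β : Type*} (X : α → Set V) (Y : β → Set V) : SimpleGraph (α ⊕ β) :=
  SimpleGraph.fromRel fun s t => ∃ a b, s = Sum.inl a ∧ t = Sum.inr b ∧ (X a ∩ Y b).Nonempty

theorem crossingGraph_adj {V α β : Type*} {X : α → Set V} {Y : β → Set V} {a : α} {b : β} :
    (crossingGraph X Y).Adj (Sum.inl a) (Sum.inr b) ↔ (X a ∩ Y b).Nonempty := by
  simp [crossingGraph]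

theorem minorOf_boxProd_crossingGraph {V α β : Type*} {G : SimpleGraph V} {X : α → Set V}
    {Y : β → Set V} (hX : ∀ a, ConnSet G (X a)) (hXd : Pairwise fun a b => Disjoint (X a) (X b))
    (hY : ∀ b, ConnSet G (Y b)) (hYd : Pairwise fun a b => Disjoint (Y a) (Y b)) :
    MinorOf (crossingGraph X Y) (G.boxProd (completeGraph (Fin 2))) := by
  have hadj : ∀ i : Fin 2, ∀ u v, G.Adj u v →
      (G.boxProd (completeGraph (Fin 2))).Adj (u, i) (v, i) := by
    intro i u v h
    simp [boxProd_adj, h]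
  have hcross : ∀ a b, (X a ∩ Y b).Nonempty → ∃ u ∈ (fun v => (v, (0 : Fin 2))) '' X a,
      ∃ v ∈ (fun v => (v, (1 : Fin 2))) '' Y b, (G.boxProd (completeGraph (Fin 2))).Adj u v := by
    rintro a b ⟨v, ha, hb⟩
    exact ⟨_, ⟨v, ha, rfl⟩, _, ⟨v, hb, rfl⟩, by simp [boxProd_adj]⟩
  refine minorOf_iff.2 ⟨Sum.elim (fun a => (fun v => (v, 0)) '' X a)
    (fun b => (fun v => (v, 1)) '' Y b), ?_, ?_, ?_⟩
  · rintro (a | a) (b | b) hab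
    · exact (Set.disjoint_image_iff fun u v h => (Prod.mk.inj h).1).2 (hXd fun h => hab (h ▸ rfl))
    · simp [Set.disjoint_left]
    · simp [Set.disjoint_left]
    · exact (Set.disjoint_image_iff fun u v h => (Prod.mk.inj h).1).2 (hYd fun h => hab (h ▸ rfl))
  · rintro (a | b)
    · exact (hX a).image _ (hadj 0)
    · exact (hY b).image _ (hadj 1)
  · intro s t h
    rw [crossingGraph, fromRel_adj] at h
    obtain ⟨-, ⟨a, b, rfl, rfl, h⟩ | ⟨a, b, rfl, rfl, h⟩⟩ := h
    · exact hcross a b h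
    · obtain ⟨u, hu, v, hv, huv⟩ := hcross a b h
      exact ⟨v, hv, u, hu, huv.symm⟩

open Classical in
theorem card_crossing_le_arcs {V α β : Type*} [Fintype α] [Fintype β] (X : α → Set V)
    (Y : β → Set V) :
    (Finset.univ.filter fun x : α × β => (X x.1 ∩ Y x.2).Nonempty).card ≤
      arcs (crossingGraph X Y) Finset.univ := by
  rw [Finset.card_filter, Fintype.sum_prod_type, arcs, Fintype.sum_sum_type]
  refine le_trans (Finset.sum_le_sum fun a _ => ?_) (Nat.le_add_right _ _)
  rw [← Finset.card_filter]
  refine Finset.card_le_card_of_injOn Sum.inr (fun b hb => ?_) Sum.inr_injective.injOn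
  simpa [mem_nbrs, crossingGraph_adj] using hb

theorem completeMinor_crossingGraph {V : Type*} {l : ℕ} {P : Fin l → Set V}
    {Q : {x : Fin l × Fin l // x.1 < x.2} → Set V} (h₁ : ∀ e, (Q e ∩ P e.1.1).Nonempty)
    (h₂ : ∀ e, (Q e ∩ P e.1.2).Nonempty) :
    MinorOf (completeGraph (Fin l)) (crossingGraph P Q) := by
  have hlt : ∀ i j, i < j → ∃ u ∈ ({s | s = Sum.inl i ∨ ∃ e, s = Sum.inr e ∧ e.1.1 = i} :
      Set (Fin l ⊕ {x : Fin l × Fin l // x.1 < x.2})),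
      (crossingGraph P Q).Adj u (Sum.inl j) := by
    intro i j hij
    refine ⟨Sum.inr ⟨(i, j), hij⟩, Or.inr ⟨_, rfl, rfl⟩, (crossingGraph_adj.2 ?_).symm⟩
    rw [Set.inter_comm]
    exact h₂ ⟨(i, j), hij⟩
  refine minorOf_iff.2 ⟨fun i => {s | s = Sum.inl i ∨ ∃ e, s = Sum.inr e ∧ e.1.1 = i}, ?_, ?_, ?_⟩
  · intro i j hij
    refine Set.disjoint_left.2 ?_
    rintro s (rfl | ⟨e, rfl, rfl⟩) (h | ⟨f, h, h'⟩)
    · exact hij (Sum.inl_injective h)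
    · cases h
    · cases h
    · exact hij (by rw [Sum.inr_injective h, h'])
  · intro i
    refine ConnSet.star (c := Sum.inl i) (Or.inl rfl) ?_
    rintro s (rfl | ⟨e, rfl, rfl⟩)
    · exact Or.inl rfl
    · refine Or.inr (crossingGraph_adj.2 ?_)
      rw [Set.inter_comm]
      exact h₁ e
  · intro i j hij
    rcases lt_or_gt_of_ne hij.ne with h | h
    · obtain ⟨u, hu, huv⟩ := hlt i j h
      exact ⟨u, hu, _, Or.inl rfl, huv⟩
    · obtain ⟨u, hu, huv⟩ := hlt j i h
      exact ⟨_, Or.inl rfl, u, hu, huv.symm⟩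

/-- The numerical form of the main theorem. -/
theorem completeMinor_boxProd {V : Type} [Fintype V] {G : SimpleGraph V} {l p : ℕ}
    (hl₀ : 0 < l) (hp₀ : 0 < p) (hp : 2 * 9 ^ p ≤ 10 ^ p)
    (hl : l * (9 ^ p) ^ (2 * p) < (10 ^ p) ^ (2 * p))
    (htw : 4 * (l * (16 * (2000 * l * p) * l ^ 2)) < treewidth G) :
    MinorOf (completeGraph (Fin l)) (G.boxProd (completeGraph (Fin 2))) := by
  classical
  set k := 16 * (2000 * l * p) * l ^ 2 with hk
  have hkpos : 0 < k := by positivity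
  obtain ⟨𝓑, hconn, hinter, hord⟩ := exists_intersecting_bramble G (l * k) htw
  obtain ⟨P, hP, hPd, hlink⟩ := exists_connSets_hasLinkage (n := l) (k := k) hkpos hconn hinter hord
  choose Q hQd hQ hQl hQr using hlink
  by_cases hdense : ∃ e f : {x : Fin l × Fin l // x.1 < x.2},
      4 * (2000 * l * p) * k ≤ (Finset.univ.filter fun x : Fin k × Fin k =>
        (Q e.1.1 e.1.2 x.1 ∩ Q f.1.1 f.1.2 x.2).Nonempty).card
  · obtain ⟨e, f, hef⟩ := hdense
    have : Nonempty (Fin k) := ⟨⟨0, hkpos⟩⟩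
    refine (completeMinor_of_arcs hl₀ hp₀ hp hl ?_).trans
      (minorOf_boxProd_crossingGraph (hQ e.1.1 e.1.2) (hQd e.1.1 e.1.2) (hQ f.1.1 f.1.2)
        (hQd f.1.1 f.1.2))
    refine le_trans (le_of_eq ?_) (hef.trans (card_crossing_le_arcs _ _))
    rw [Fintype.card_sum, Fintype.card_fin]
    ring
  · push Not at hdense
    obtain ⟨τ, hτ⟩ := exists_conflictFree (E := {x : Fin l × Fin l // x.1 < x.2}) (k := k)
      (C := fun e f a b => (Q e.1.1 e.1.2 a ∩ Q f.1.1 f.1.2 b).Nonempty)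
      (M := 4 * (2000 * l * p) * k) hkpos (fun e f a b h => by rwa [Set.inter_comm])
      (fun e f _ => (hdense e f).le) (by
        have h₁ : Fintype.card {x : Fin l × Fin l // x.1 < x.2} ≤ l ^ 2 :=
          (Fintype.card_subtype_le _).trans (by simp [sq])
        calc _ ≤ 4 * (l ^ 2 * (4 * (2000 * l * p) * k)) := by gcongr
          _ = (16 * (2000 * l * p) * l ^ 2) * k := by ring
          _ = k ^ 2 := by rw [← hk, sq])
    exact (completeMinor_crossingGraph (P := P) (fun e => hQl e.1.1 e.1.2 (τ e))
      fun e => hQr e.1.1 e.1.2 (τ e)).trans (minorOf_boxProd_crossingGraph hP hPd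
        (fun e => hQ _ _ _) fun e f hef =>
          Set.disjoint_iff_inter_eq_empty.2 (Set.not_nonempty_iff_eq_empty.1 (hτ e f hef)))

theorem exists_parameter {l : ℕ} (hl : 2 ≤ l) :
    ∃ p : ℕ, 0 < p ∧ 2 * 9 ^ p ≤ 10 ^ p ∧ l * (9 ^ p) ^ (2 * p) < (10 ^ p) ^ (2 * p) ∧
      (p : ℝ) ≤ 13 * Real.sqrt (Real.log l) := by
  have hlog : (0.64 : ℝ) ≤ Real.log l :=
    le_trans (by linarith [Real.log_two_gt_d9])
      (Real.log_le_log two_pos (by exact_mod_cast hl))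
  set x := Real.sqrt (Real.log l) with hx
  have hx₁ : (0.8 : ℝ) ≤ x := Real.le_sqrt_of_sq_le (by norm_num; linarith)
  have hx₂ : x ^ 2 = Real.log l := Real.sq_sqrt (by linarith)
  refine ⟨⌊3 * x⌋₊ + 7, by omega, ?_, ?_, ?_⟩
  · generalize ⌊3 * x⌋₊ = m
    induction m with
    | zero => norm_num
    | succ m ih =>
      rw [show m + 1 + 7 = m + 7 + 1 by ring, pow_succ 9 (m + 7), pow_succ 10 (m + 7)]
      generalize 9 ^ (m + 7) = y at *
      generalize 10 ^ (m + 7) = z at *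
      omega
  · set p := ⌊3 * x⌋₊ + 7 with hp
    have h₁ : 3 * x < p := by
      rw [hp]
      push_cast
      linarith [Nat.lt_floor_add_one (3 * x)]
    have h₂ : (1 / 10 : ℝ) ≤ Real.log (10 / 9) := by
      have := Real.one_sub_inv_le_log_of_pos (x := 10 / 9) (by norm_num)
      norm_num at this ⊢
      exact this
    have h₃ : Real.log l < Real.log ((10 / 9) ^ (p * (2 * p))) := by
      rw [Real.log_pow]
      push_cast
      have h₅ : (3 * x) ^ 2 < (p : ℝ) ^ 2 := by gcongr
      have h₆ : (p : ℝ) * (2 * p) * (1 / 10) ≤ p * (2 * p) * Real.log (10 / 9) := by gcongr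
      nlinarith
    have h₄ : (l : ℝ) < (10 / 9) ^ (p * (2 * p)) :=
      (Real.log_lt_log_iff (by positivity) (by positivity)).1 h₃
    rw [div_pow, lt_div_iff₀ (by positivity)] at h₄
    rw [← pow_mul, ← pow_mul]
    exact_mod_cast h₄
  · push_cast
    have := Nat.floor_le (show 0 ≤ 3 * x by linarith)
    linarith

/-- **Theorem (Reed–Wood).** There is a constant `c > 0` such that for every
integer `ℓ ≥ 2`, if `G` has treewidth at least `c·ℓ⁴·√(log ℓ)`, then `G □ K₂`
contains a `K_ℓ`-minor. -/
theorem boxProd_completeMinor_of_large_treewidth :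
    ∃ c : ℝ, 0 < c ∧
      ∀ (ℓ : ℕ), 2 ≤ ℓ →
        ∀ (V : Type) [Fintype V] (G : SimpleGraph V),
          c * (ℓ : ℝ) ^ 4 * Real.sqrt (Real.log ℓ) ≤ (treewidth G : ℝ) →
          MinorOf (completeGraph (Fin ℓ)) (G.boxProd (completeGraph (Fin 2))) := by
  refine ⟨2000000, by norm_num, fun l hl V _ G htw => ?_⟩
  obtain ⟨p, hp₀, hp, hlp, hpx⟩ := exists_parameter hl
  refine completeMinor_boxProd (by omega) hp₀ hp hlp ?_
  have hl' : (0 : ℝ) < (l : ℝ) ^ 4 := by positivity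
  have hp' : (1 : ℝ) ≤ p := by exact_mod_cast hp₀
  have h : ((4 * (l * (16 * (2000 * l * p) * l ^ 2)) : ℕ) : ℝ) < treewidth G := by
    refine lt_of_lt_of_le ?_ htw
    push_cast
    nlinarith
  exact_mod_cast h
end

section
/- Let ℬ be a bramble in a finite simple graph G. Then G contains a path that intersects (has a common vertex with) every element of ℬ. -/
open SimpleGraph

namespace SimpleGraph.Walk

variable {V : Type*} {G : SimpleGraph V} {u v w : V}

/-- A walk ending in `S` can be cut off at its first vertex in `S`. -/
theorem exists_support_subset_first_mem (S : Set V) (p : G.Walk u v) (hv : v ∈ S) :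
    ∃ w ∈ S, ∃ q : G.Walk u w, q.support ⊆ p.support ∧ ∀ z ∈ q.support, z ∈ S → z = w := by
  induction p with
  | nil => exact ⟨_, hv, nil, by simp, by simp⟩
  | @cons a b c hab p ih =>
    by_cases ha : a ∈ S
    · exact ⟨a, ha, nil, by simp, by simp⟩
    · obtain ⟨w, hw, q, hqp, hqS⟩ := ih hv
      refine ⟨w, hw, cons hab q, ?_, ?_⟩
      · simpa using List.subset_cons_of_subset a hqp
      · intro z hz hzS
        rw [support_cons, List.mem_cons] at hz
        rcases hz with rfl | hz
        · exact absurd hzS ha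
        · exact hqS z hz hzS

/-- Two paths that share only the vertex at which they are joined concatenate to a path. -/
theorem IsPath.append_of_forall_mem_support {p : G.Walk u v} {q : G.Walk v w} (hp : p.IsPath)
    (hq : q.IsPath) (h : ∀ z ∈ p.support, z ∈ q.support → z = v) : (p.append q).IsPath := by
  rw [isPath_def, support_append, List.nodup_append]
  refine ⟨hp.support_nodup, hq.support_nodup.tail, ?_⟩
  rintro a ha _ hb rfl
  obtain rfl := h a ha (List.mem_of_mem_tail hb)
  have := hq.support_nodup
  rw [← cons_tail_support, List.nodup_cons] at this
  exact this.1 hb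

end SimpleGraph.Walk

/-- From any vertex of a connected subgraph `X` there is a walk to any subgraph `Y` touching `X`,
using only vertices of `X` and `Y`. -/
theorem Touch.exists_walk {V : Type} {G : SimpleGraph V} {X Y : G.Subgraph} (h : Touch X Y)
    (hX : X.Connected) {v : V} (hv : v ∈ X.verts) :
    ∃ w ∈ Y.verts, ∃ p : G.Walk v w, ∀ z ∈ p.support, z ∈ X.verts ∨ z ∈ Y.verts := by
  have hwalk : ∀ {w}, w ∈ X.verts → ∃ p : G.Walk v w, ∀ z ∈ p.support, z ∈ X.verts := by
    intro w hw
    obtain ⟨p, hp⟩ := (X.connected_iff_forall_exists_walk_subgraph.1 hX).2 hv hw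
    exact ⟨p, fun z hz => hp.1 (p.mem_verts_toSubgraph.2 hz)⟩
  rcases h with ⟨w, hwX, hwY⟩ | ⟨x, hx, w, hw, hadj⟩
  · obtain ⟨p, hp⟩ := hwalk hwX
    exact ⟨w, hwY, p, fun z hz => .inl (hp z hz)⟩
  · obtain ⟨p, hp⟩ := hwalk hx
    refine ⟨w, hw, p.concat hadj, fun z hz => ?_⟩
    rw [Walk.support_concat, List.mem_append, List.mem_singleton] at hz
    rcases hz with hz | rfl
    · exact .inl (hp z hz)
    · exact .inr hw

/-- A path meeting the connected subgraph `X` only in its last vertex and avoiding a subgraph `Y`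
that touches `X` extends to a longer path meeting `Y` only in its last vertex. -/
theorem Touch.exists_longer_path {V : Type} {G : SimpleGraph V} {X Y : G.Subgraph}
    (h : Touch X Y) (hX : X.Connected) {u v : V} {p : G.Walk u v} (hp : p.IsPath)
    (hv : v ∈ X.verts) (hpX : ∀ z ∈ p.support, z ∈ X.verts → z = v)
    (hpY : ∀ z ∈ p.support, z ∉ Y.verts) :
    ∃ w ∈ Y.verts, ∃ q : G.Walk u w, q.IsPath ∧ p.length < q.length ∧
      ∀ z ∈ q.support, z ∈ Y.verts → z = w := by
  classical
  obtain ⟨y, hy, r, hr⟩ := h.exists_walk hX hv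
  obtain ⟨w, hw, q, hqr, hqY⟩ := r.exists_support_subset_first_mem Y.verts hy
  have hvw : v ≠ w := by
    rintro rfl
    exact hpY v p.end_mem_support hw
  have hsub := q.support_bypass_subset_support
  refine ⟨w, hw, p.append q.bypass,
    hp.append_of_forall_mem_support q.bypass_isPath fun z hzp hzq => ?_, ?_, fun z hz hzY => ?_⟩
  · exact hpX z hzp ((hr z (hqr (hsub hzq))).resolve_right (hpY z hzp))
  · have : 0 < q.bypass.length :=
      Nat.pos_of_ne_zero fun h0 => hvw (Walk.eq_of_length_eq_zero h0)
    rw [Walk.length_append]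
    lia
  · rcases (Walk.mem_support_append_iff _ _).1 hz with hz | hz
    · exact absurd hzY (hpY z hz)
    · exact hqY z (hsub hz) hzY

/-- Every bramble in a (nonempty) finite graph is hit by a single path. -/
theorem exists_path_hitting_bramble {V : Type} [Fintype V] [Nonempty V]
    {G : SimpleGraph V} (ℬ : Set G.Subgraph) (h : IsBramble ℬ) :
    ∃ P : PathIn G, ∀ X ∈ ℬ, ∃ v ∈ P.verts, v ∈ X.verts := by
  by_contra! hno
  have hmiss : ∀ {u v : V} {p : G.Walk u v}, p.IsPath →
      ∃ X ∈ ℬ, ∀ z ∈ p.support, z ∉ X.verts := fun hp => hno ⟨_, _, _, hp⟩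
  have hlong : ∀ n : ℕ, ∃ X ∈ ℬ, ∃ u, ∃ v ∈ X.verts, ∃ p : G.Walk u v,
      p.IsPath ∧ n ≤ p.length ∧ ∀ z ∈ p.support, z ∈ X.verts → z = v := by
    intro n
    induction n with
    | zero =>
      obtain ⟨X, hX, -⟩ := hmiss (.nil : (Walk.nil : G.Walk (Classical.arbitrary V) _).IsPath)
      obtain ⟨v, hv⟩ := (h.1 X hX).nonempty
      exact ⟨X, hX, v, v, hv, .nil, .nil, Nat.zero_le _, by simp⟩
    | succ n ih =>
      obtain ⟨X, hX, u, v, hv, p, hp, hn, hpX⟩ := ih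
      obtain ⟨Y, hY, hpY⟩ := hmiss hp
      obtain ⟨w, hw, q, hq, hlt, hqY⟩ :=
        (h.2 X hX Y hY).exists_longer_path (h.1 X hX) hp hv hpX hpY
      exact ⟨Y, hY, u, w, hw, q, hq, by lia, hqY⟩
  obtain ⟨_, _, _, _, _, _, hp, hn, _⟩ := hlong (Fintype.card V)
  exact hp.length_lt.not_ge hn
end

section
/- Let H be the intersection graph of a set 𝒳 of connected subgraphs of a finite simple graph G. If H contains the complete graph K_ℓ as a minor, and H contains no subgraph isomorphic to the complete graph K_{r+1}, then the treewidth of G is at least ⌈ℓ/r⌉ − 1. -/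
open SimpleGraph

namespace SimpleGraph

variable {V : Type*} {G : SimpleGraph V} {A B C : Set V}

lemma Preconnected.exists_walk_of_induce (h : (G.induce A).Preconnected) {x y : V}
    (hx : x ∈ A) (hy : y ∈ A) : ∃ p : G.Walk x y, ∀ z ∈ p.support, z ∈ A := by
  obtain ⟨p⟩ := h ⟨x, hx⟩ ⟨y, hy⟩
  refine ⟨p.map (Embedding.induce A).toHom, fun z hz => ?_⟩
  obtain ⟨w, -, rfl⟩ := List.mem_map.1 (Walk.support_map _ p ▸ hz)
  exact w.2

/-- The union of a family of connected vertex sets, indexed by the vertices of a connected graph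
such that adjacent indices have intersecting sets, is connected. -/
lemma Preconnected.induce_iUnion {α : Type*} {K : SimpleGraph α} (hK : K.Preconnected)
    {S : α → Set V} (hS : ∀ a, (G.induce (S a)).Preconnected)
    (hadj : ∀ a b, K.Adj a b → (S a ∩ S b).Nonempty) :
    (G.induce (⋃ a, S a)).Preconnected := by
  have within (a : α) {x y : V} (hx : x ∈ S a) (hy : y ∈ S a) :
      (G.induce (⋃ a, S a)).Reachable ⟨x, Set.mem_iUnion_of_mem a hx⟩
        ⟨y, Set.mem_iUnion_of_mem a hy⟩ :=
    (hS a ⟨x, hx⟩ ⟨y, hy⟩).map (G.induceHomOfLE (Set.subset_iUnion S a)).toHom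
  rintro ⟨x, hx⟩ ⟨y, hy⟩
  obtain ⟨a, ha⟩ := Set.mem_iUnion.1 hx
  obtain ⟨b, hb⟩ := Set.mem_iUnion.1 hy
  obtain ⟨p⟩ := hK a b
  induction p generalizing x with
  | nil => exact within _ ha hb
  | cons h _ ih =>
    obtain ⟨m, hm, hm'⟩ := hadj _ _ h
    exact (within _ ha hm).trans (ih m (Set.mem_iUnion_of_mem _ hm') hm' hb)

namespace IsAcyclic

lemma support_subset_of_isPath (hG : G.IsAcyclic) {x y : V} {p : G.Walk x y} (hp : p.IsPath)
    (q : G.Walk x y) : p.support ⊆ q.support := by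
  classical
  have h : p = q.bypass :=
    congrArg Subtype.val ((hG.subsingleton_path x y).elim ⟨p, hp⟩ ⟨_, q.bypass_isPath⟩)
  exact h ▸ q.support_bypass_subset_support

lemma preconnected_induce_inter (hG : G.IsAcyclic) (hA : (G.induce A).Preconnected)
    (hB : (G.induce B).Preconnected) : (G.induce (A ∩ B)).Preconnected := by
  classical
  rintro ⟨x, hxA, hxB⟩ ⟨y, hyA, hyB⟩
  obtain ⟨p, hp⟩ := hA.exists_walk_of_induce hxA hyA
  obtain ⟨q, hq⟩ := hB.exists_walk_of_induce hxB hyB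
  exact ⟨p.bypass.induce (A ∩ B) fun z hz => ⟨hp z (p.support_bypass_subset_support hz),
    hq z (hG.support_subset_of_isPath p.bypass_isPath q hz)⟩⟩

lemma inter_inter_nonempty (hG : G.IsAcyclic) (hA : (G.induce A).Preconnected)
    (hB : (G.induce B).Preconnected) (hC : (G.induce C).Preconnected)
    (hAB : (A ∩ B).Nonempty) (hBC : (B ∩ C).Nonempty) (hAC : (A ∩ C).Nonempty) : (A ∩ B ∩ C).Nonempty := by
  classical
  obtain ⟨a, haA, haB⟩ := hAB
  obtain ⟨b, hbB, hbC⟩ := hBC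
  obtain ⟨c, hcA, hcC⟩ := hAC
  by_cases hbA : b ∈ A
  · exact ⟨b, ⟨hbA, hbB⟩, hbC⟩
  obtain ⟨p, hp⟩ := hB.exists_walk_of_induce haB hbB
  obtain ⟨q, hq⟩ := hA.exists_walk_of_induce haA hcA
  obtain ⟨s, hs⟩ := hC.exists_walk_of_induce hcC hbC
  have hpB : ∀ z ∈ p.bypass.support, z ∈ B := fun z hz => hp z (p.support_bypass_subset_support hz)
  have hpAC : ∀ z ∈ p.bypass.support, z ∈ A ∨ z ∈ C := fun z hz =>
    ((Walk.mem_support_append_iff q s).1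
      (hG.support_subset_of_isPath p.bypass_isPath (q.append s) hz)).imp (hq z) (hs z)
  obtain ⟨⟨⟨x, y⟩, hxy⟩, hd, hxA, hyA⟩ := p.bypass.exists_boundary_dart A haA hbA
  have hx := p.bypass.dart_fst_mem_support_of_mem_darts hd
  have hyC := (hpAC y (p.bypass.dart_snd_mem_support_of_mem_darts hd)).resolve_left hyA
  refine ⟨x, ⟨hxA, hpB x hx⟩, by_contra fun hxC => ?_⟩
  obtain ⟨u, hu⟩ := hA.exists_walk_of_induce hxA hcA
  obtain ⟨v, hv⟩ := hC.exists_walk_of_induce hcC hyC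
  have hmem := isBridge_iff_forall_walk_mem_edges.1
    (isAcyclic_iff_forall_adj_isBridge.1 hG hxy) (u.append v)
  rw [Walk.edges_append, List.mem_append] at hmem
  rcases hmem with h | h
  · exact hyA (hu _ (u.snd_mem_support_of_mem_edges h))
  · exact hxC (hv _ (v.fst_mem_support_of_mem_edges h))

/-- The Helly property of subtrees: finitely many pairwise intersecting connected vertex sets of a
forest have a common element. -/
lemma exists_mem_of_pairwise_inter_nonempty (hG : G.IsAcyclic) {α : Type*} {s : Finset α}
    (hs : s.Nonempty) {S : α → Set V} (hS : ∀ a ∈ s, (G.induce (S a)).Preconnected)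
    (hinter : ∀ a ∈ s, ∀ b ∈ s, (S a ∩ S b).Nonempty) : ∃ x, ∀ a ∈ s, x ∈ S a := by
  induction hs using Finset.Nonempty.cons_induction generalizing S with
  | singleton a => simpa [Set.Nonempty] using hinter
  | cons a s _ hne ih =>
    simp only [Finset.forall_mem_cons] at hS hinter
    obtain ⟨x, hx⟩ := ih (S := fun b => S b ∩ S a)
      (fun b hb => hG.preconnected_induce_inter (hS.2 b hb) hS.1) fun b hb c hc => by
        rw [← Set.inter_inter_distrib_right]
        exact hG.inter_inter_nonempty (hS.2 b hb) (hS.2 c hc) hS.1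
          ((hinter.2 b hb).2 c hc) (hinter.2 c hc).1 (hinter.2 b hb).1
    obtain ⟨b, hb⟩ := hne
    exact ⟨x, Finset.forall_mem_cons .. |>.2 ⟨(hx b hb).2, fun c hc => (hx c hc).1⟩⟩

end IsAcyclic

end SimpleGraph

namespace TreeDecomp

variable {V : Type} {G : SimpleGraph V}

/-- The tree decomposition with a single bag. -/
def singleBag [Fintype V] (G : SimpleGraph V) : TreeDecomp G where
  ι := Unit
  tree := ⊥
  isTree := .of_subsingleton
  bag _ := Finset.univ
  mem_bag v := ⟨(), Finset.mem_univ v⟩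
  adj_bag u v _ := ⟨(), Finset.mem_univ u, Finset.mem_univ v⟩
  connected_bag v :=
    have : Nonempty {_i : Unit | v ∈ (Finset.univ : Finset V)} := ⟨⟨(), Finset.mem_univ v⟩⟩
    ⟨.of_subsingleton⟩

lemma card_bag_le_width_add_one [Fintype V] (td : TreeDecomp G) (i : td.ι) :
    (td.bag i).card ≤ td.width + 1 := by
  have hbdd : BddAbove {n | ∃ i, n = (td.bag i).card} :=
    ⟨Fintype.card V, by rintro _ ⟨j, rfl⟩; exact Finset.card_le_univ _⟩
  have := le_csSup hbdd ⟨i, rfl⟩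
  unfold width
  omega

lemma preconnected_induce_subgraph (td : TreeDecomp G) {X : G.Subgraph} (hX : X.Connected) :
    (td.tree.induce (⋃ v : X.verts, {i | ↑v ∈ td.bag i})).Preconnected :=
  hX.preconnected.coe.induce_iUnion (fun v => (td.connected_bag v).preconnected)
    fun u v huv => td.adj_bag u v (X.adj_sub huv)

/-- Suppose the intersection graph of a set of connected subgraphs has a complete minor. Then some
bag meets, for every branch set, a member of that branch set. -/
lemma exists_bag_of_intersectionGraph_minor (td : TreeDecomp G) {𝒳 : Set G.Subgraph}
    (hconn : ∀ X ∈ 𝒳, X.Connected) {α : Type*} [Finite α] {B : α → Set 𝒳}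
    (hB : ∀ a, ((subgraphIntersectionGraph G 𝒳).induce (B a)).Connected)
    (hadj : ∀ a b, a ≠ b → ∃ X ∈ B a, ∃ Y ∈ B b, (subgraphIntersectionGraph G 𝒳).Adj X Y) :
    ∃ i, ∀ a, ∃ X ∈ B a, ∃ v ∈ X.1.verts, v ∈ td.bag i := by
  have hshare {X Y : 𝒳} (h : (subgraphIntersectionGraph G 𝒳).Adj X Y) :
      ∃ v, v ∈ X.1.verts ∧ v ∈ Y.1.verts := by
    rcases h.2 with ⟨v, h₁, h₂⟩ | ⟨v, h₁, h₂⟩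
    exacts [⟨v, h₁, h₂⟩, ⟨v, h₂, h₁⟩]
  let T (X : 𝒳) : Set td.ι := ⋃ v : X.1.verts, {i | ↑v ∈ td.bag i}
  have mem_T {X : 𝒳} {i : td.ι} : i ∈ T X ↔ ∃ v ∈ X.1.verts, v ∈ td.bag i := by simp [T]
  let S (a : α) : Set td.ι := ⋃ X : B a, T X
  have mem_S {a : α} {i : td.ι} : i ∈ S a ↔ ∃ X ∈ B a, i ∈ T X := by simp [S]
  have hT {X Y : 𝒳} (h : ∃ v, v ∈ X.1.verts ∧ v ∈ Y.1.verts) : (T X ∩ T Y).Nonempty := by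
    obtain ⟨v, hvX, hvY⟩ := h
    obtain ⟨i, hi⟩ := td.mem_bag v
    exact ⟨i, mem_T.2 ⟨v, hvX, hi⟩, mem_T.2 ⟨v, hvY, hi⟩⟩
  have hS (a : α) : (td.tree.induce (S a)).Preconnected :=
    (hB a).preconnected.induce_iUnion
      (fun X => td.preconnected_induce_subgraph (hconn X.1 X.1.2)) fun X Y h => hT (hshare h)
  have hinter (a b : α) : (S a ∩ S b).Nonempty := by
    have : ∃ X ∈ B a, ∃ Y ∈ B b, ∃ v, v ∈ X.1.verts ∧ v ∈ Y.1.verts := by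
      rcases eq_or_ne a b with rfl | hab
      · obtain ⟨X, hX⟩ := (hB a).nonempty
        obtain ⟨v, hv⟩ := (hconn X X.2).nonempty
        exact ⟨X, hX, X, hX, v, hv, hv⟩
      · obtain ⟨X, hX, Y, hY, h⟩ := hadj a b hab
        exact ⟨X, hX, Y, hY, hshare h⟩
    obtain ⟨X, hX, Y, hY, h⟩ := this
    obtain ⟨i, hiX, hiY⟩ := hT h
    exact ⟨i, mem_S.2 ⟨X, hX, hiX⟩, mem_S.2 ⟨Y, hY, hiY⟩⟩
  cases nonempty_fintype α
  obtain hα | hα := isEmpty_or_nonempty α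
  · exact ⟨td.isTree.connected.nonempty.some, fun a => isEmptyElim a⟩
  obtain ⟨i, hi⟩ := td.isTree.isAcyclic.exists_mem_of_pairwise_inter_nonempty
    Finset.univ_nonempty (fun a _ => hS a) fun a _ b _ => hinter a b
  refine ⟨i, fun a => ?_⟩
  obtain ⟨X, hX, hiX⟩ := mem_S.1 (hi a (Finset.mem_univ a))
  exact ⟨X, hX, mem_T.1 hiX⟩

end TreeDecomp

/-- Subgraphs picked from a set whose intersection graph has no clique of size `r + 1`, each
meeting a finite set `s`, number at most `r` times the size of `s`. -/
lemma card_le_mul_card_of_cliqueFree {V : Type} {G : SimpleGraph V} {𝒳 : Set G.Subgraph} {r : ℕ}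
    (hfree : (subgraphIntersectionGraph G 𝒳).CliqueFree (r + 1)) {α : Type*} [Fintype α]
    {X : α → 𝒳} (hX : X.Injective) {s : Finset V} (hs : ∀ a, ∃ v ∈ (X a).1.verts, v ∈ s) :
    Fintype.card α ≤ r * s.card := by
  classical
  choose v hvX hvs using hs
  refine Finset.card_le_mul_card_image_of_maps_to (f := v) (fun a _ => hvs a) r fun w _ => ?_
  by_contra! hlt
  have hclique : (subgraphIntersectionGraph G 𝒳).IsClique
      (({a | v a = w} : Finset α).image X : Finset 𝒳) := by
    intro Y hY Z hZ hne
    simp only [Finset.coe_image, Finset.coe_filter, Finset.mem_univ, true_and, Set.mem_image,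
      Set.mem_ofPred_eq] at hY hZ
    obtain ⟨a, ha, rfl⟩ := hY
    obtain ⟨b, hb, rfl⟩ := hZ
    exact ⟨hne, Or.inl ⟨w, ha ▸ hvX a, hb ▸ hvX b⟩⟩
  refine hfree.mono ?_ _ ⟨hclique, rfl⟩
  rwa [Finset.card_image_of_injective _ hX]

/-- If the intersection graph `H` of a set of connected subgraphs of `G`
contains a `K_ℓ`-minor and has no `K_{r+1}` subgraph, then the treewidth of
`G` is at least `⌈ℓ/r⌉ - 1`. -/
theorem treewidth_ge_of_intersectionGraph_minor {V : Type} [Fintype V]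
    {G : SimpleGraph V} (𝒳 : Set G.Subgraph) (hconn : ∀ X ∈ 𝒳, X.Connected)
    (ℓ r : ℕ)
    (hminor : MinorOf (completeGraph (Fin ℓ)) (subgraphIntersectionGraph G 𝒳))
    (hfree : (subgraphIntersectionGraph G 𝒳).CliqueFree (r + 1)) :
    (ℓ + r - 1) / r - 1 ≤ treewidth G := by
  obtain ⟨B, hdisj, hB, hadj⟩ := hminor
  obtain ⟨td, htd⟩ := Nat.sInf_mem (s := {w | ∃ td : TreeDecomp G, td.width = w})
    ⟨_, TreeDecomp.singleBag G, rfl⟩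
  obtain ⟨i, hi⟩ := td.exists_bag_of_intersectionGraph_minor hconn hB hadj
  choose X hXB hX using hi
  have hinj : X.Injective := fun a b h => by
    by_contra hab
    exact Set.disjoint_left.1 (hdisj hab) (hXB a) (h ▸ hXB b)
  have hcard := card_le_mul_card_of_cliqueFree hfree hinj hX
  rw [Fintype.card_fin] at hcard
  rw [treewidth, ← htd, Nat.sub_le_iff_le_add]
  refine le_trans ?_ (td.card_bag_le_width_add_one i)
  rcases r.eq_zero_or_pos with rfl | hr
  · simp
  · refine Nat.lt_succ_iff.1 ((Nat.div_lt_iff_lt_mul hr).2 ?_)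
    rw [Nat.succ_mul, mul_comm]
    omega
end

section
/- If H is the intersection graph of a set of connected subgraphs of a finite simple graph G, then H is a minor of the cartesian product G □ K_{χ(H)}, where χ(H) denotes the chromatic number of H. -/
open SimpleGraph

/-- A connected subgraph stays connected when it is placed in one layer of a box product. -/
theorem SimpleGraph.Subgraph.Connected.induce_boxProd_layer {V W : Type*} {G : SimpleGraph V}
    {X : G.Subgraph} (hX : X.Connected) (K : SimpleGraph W) (c : W) :
    ((G.boxProd K).induce (X.verts ×ˢ {c})).Connected := by
  let f : X.coe →g (G.boxProd K).induce (X.verts ×ˢ {c}) :=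
    { toFun := fun v => ⟨(v, c), v.2, rfl⟩
      map_rel' := fun h => Or.inl ⟨X.adj_sub h, rfl⟩ }
  refine hX.coe.map f ?_
  rintro ⟨⟨v, d⟩, hv, rfl⟩
  exact ⟨⟨v, hv⟩, rfl⟩

/-- The intersection graph of connected subgraphs of `G` is a minor of the box product of `G`
with any complete graph whose vertices properly colour it. -/
theorem minorOf_boxProd_of_coloring {V : Type} {W : Type*} {G : SimpleGraph V}
    {𝒳 : Set G.Subgraph} (hconn : ∀ X ∈ 𝒳, X.Connected)
    (C : (subgraphIntersectionGraph G 𝒳).Coloring W) :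
    MinorOf (subgraphIntersectionGraph G 𝒳) (G.boxProd (completeGraph W)) := by
  refine ⟨fun X => (X : G.Subgraph).verts ×ˢ {C X}, fun X Y hne => ?_,
    fun X => (hconn X X.2).induce_boxProd_layer _ _, fun X Y hXY => ?_⟩
  · refine Set.disjoint_left.2 ?_
    rintro ⟨v, d⟩ ⟨hX, hdX⟩ ⟨hY, hdY⟩
    exact C.valid (v := X) (w := Y) ⟨hne, Or.inl ⟨v, hX, hY⟩⟩ (hdX.symm.trans hdY)
  · obtain ⟨v, hX, hY⟩ :
        ((X : G.Subgraph).verts ∩ (Y : G.Subgraph).verts).Nonempty := by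
      rcases hXY.2 with h | h
      · exact h
      · rwa [Set.inter_comm]
    exact ⟨(v, C X), ⟨hX, rfl⟩, (v, C Y), ⟨hY, rfl⟩, Or.inr ⟨C.valid hXY, rfl⟩⟩

/-- The intersection graph `H` of a set of connected subgraphs of `G` is a
minor of `G □ K_{χ(H)}`. -/
theorem intersectionGraph_minor_boxProd_chromatic {V : Type} [Fintype V]
    {G : SimpleGraph V} (𝒳 : Set G.Subgraph) (hconn : ∀ X ∈ 𝒳, X.Connected) :
    MinorOf (subgraphIntersectionGraph G 𝒳)
      (G.boxProd (completeGraph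
        (Fin (subgraphIntersectionGraph G 𝒳).chromaticNumber.toNat))) := by
  exact minorOf_boxProd_of_coloring hconn (colorable_chromaticNumber_of_fintype _).some
end
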